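/- arXiv:2209.11728 — 6 statements merged into one kernel-verified Lean document; each statement's English description precedes it below -/
import Mathlib

section
/- In the one-dimensional exponential family setup, let θ₀ ≠ θ₁ be points of Θ such that the point θ₂ ∈ Θ with η(θ₂) = (η(θ₀)+η(θ₁))/2 is an interior point of Θ. Then the sequence ψ_{θ₀,θ₁}(n) = E_{θ₁}[q_n^{θ₀}] is eventually strictly decreasing: there exists N such that ψ_{θ₀,θ₁}(n+1) < ψ_{θ₀,θ₁}(n) for all n ≥ N. -/
open MeasureTheory

/-- The expected `θ₀`-posterior after `n` iid observations generated under `θ₁`: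
`ψ_{θ₀,θ₁}(n) = ∫_{X^n} (p_{θ₀}(s_n) π(θ₀) / p(s_n)) p_{θ₁}(s_n) dν^n(s_n)`, where
`p_θ(s_n) = ∏ i, p_θ(x_i)` and `p(s_n) = ∫_Θ p_θ(s_n) π(θ) dθ`. -/
noncomputable def expectedPosterior {X : Type*} [MeasurableSpace X]
    (ν : Measure X) [SigmaFinite ν]
    (Θ : Set ℝ) (π : ℝ → ℝ) (p : ℝ → X → ℝ) (θ₀ θ₁ : ℝ) (n : ℕ) : ℝ :=
  ∫ s : Fin n → X,
    ((∏ i, p θ₀ (s i)) * π θ₀ / ∫ θ in Θ, (∏ i, p θ (s i)) * π θ) *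
      (∏ i, p θ₁ (s i)) ∂(Measure.pi fun _ => ν)

namespace ExpectedPosterior

open Real Set
open scoped ENNReal

section Product

variable {X : Type*} [MeasurableSpace X]

theorem lintegral_pi_fin_succ (ν : Measure X) [SigmaFinite ν] {n : ℕ}
    {F : (Fin (n + 1) → X) → ℝ≥0∞} (hF : Measurable F) :
    ∫⁻ s, F s ∂(Measure.pi fun _ => ν)
      = ∫⁻ x, ∫⁻ t : Fin n → X, F (Fin.cons x t) ∂(Measure.pi fun _ => ν) ∂ν := by
  have hmp := (measurePreserving_piFinSuccAbove (fun _ : Fin (n + 1) => ν) 0).symm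
  rw [← hmp.lintegral_comp hF,
    lintegral_prod _ (Measurable.aemeasurable (by exact hF.comp (MeasurableEquiv.measurable _)))]
  exact lintegral_congr fun x => lintegral_congr fun t => congrArg F (Fin.insertNth_zero' x t)

theorem lintegral_pi_fin_prod (ν : Measure X) [SigmaFinite ν] {n : ℕ}
    {f : Fin n → X → ℝ≥0∞} (hf : ∀ i, Measurable (f i)) :
    ∫⁻ s : Fin n → X, ∏ i, f i (s i) ∂(Measure.pi fun _ => ν) = ∏ i, ∫⁻ x, f i x ∂ν := by
  induction n with
  | zero => simp
  | succ n ih =>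
    have hm (g : Fin n → X → ℝ≥0∞) (hg : ∀ i, Measurable (g i)) :
        Measurable fun t : Fin n → X => ∏ i, g i (t i) := by fun_prop
    rw [lintegral_pi_fin_succ ν (by fun_prop)]
    simp only [Fin.prod_univ_succ, Fin.cons_zero, Fin.cons_succ]
    simp_rw [lintegral_const_mul _ (hm (fun i => f i.succ) fun i => hf i.succ),
      ih fun i => hf i.succ]
    rw [lintegral_mul_const _ (hf 0)]

theorem pi_withDensity (ν : Measure X) [SigmaFinite ν] {f : X → ℝ≥0∞} (hf : Measurable f)
    [SigmaFinite (ν.withDensity f)] (n : ℕ) :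
    (Measure.pi fun _ : Fin n => ν.withDensity f)
      = (Measure.pi fun _ => ν).withDensity fun s => ∏ i, f (s i) := by
  refine Measure.pi_eq fun A hA => ?_
  rw [withDensity_apply _ (MeasurableSet.univ_pi hA),
    ← lintegral_indicator (MeasurableSet.univ_pi hA)]
  simp_rw [withDensity_apply _ (hA _), ← lintegral_indicator (hA _)]
  rw [← lintegral_pi_fin_prod ν fun i => hf.indicator (hA i)]
  refine lintegral_congr fun s => ?_
  by_cases hs : s ∈ univ.pi A
  · rw [indicator_of_mem hs]
    exact Finset.prod_congr rfl fun i _ => (indicator_of_mem (hs i trivial) f).symm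
  · rw [indicator_of_notMem hs]
    obtain ⟨i, hi⟩ : ∃ i, s i ∉ A i := by simpa using hs
    exact (Finset.prod_eq_zero (Finset.mem_univ i) (indicator_of_notMem hi f)).symm

end Product

section TiltMass

/-- The mass of `μ` reweighted by the log-likelihood ratio `h ↦ h * u - n * D h`. -/
noncomputable def tiltMass (μ : Measure ℝ) (D : ℝ → ℝ) (n : ℕ) (u : ℝ) : ℝ :=
  ∫ h, exp (h * u - n * D h) ∂μ

variable {μ : Measure ℝ} [IsFiniteMeasure μ] {D : ℝ → ℝ} {κ : ℝ}

theorem measurable_tiltMass (hD : Continuous D) (n : ℕ) : Measurable (tiltMass μ D n) := by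
  have h : StronglyMeasurable (Function.uncurry fun u h : ℝ => exp (h * u - n * D h)) :=
    Continuous.stronglyMeasurable (by unfold Function.uncurry; fun_prop)
  exact h.integral_prod_right.measurable

theorem integrable_tilt_Icc (hD : Continuous D) (κ : ℝ) (n : ℕ) (u : ℝ) :
    IntegrableOn (fun h => exp (h * u - n * D h)) (Icc (-κ) κ) μ :=
  Continuous.integrableOn_Icc (by fun_prop)

theorem le_tiltMass_Icc (hD : Continuous D) {L : ℝ} (hL : ∀ h ∈ Icc (-κ) κ, D h ≤ L)
    (n : ℕ) (u : ℝ) :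
    μ.real (Icc (-κ) κ) * exp (-(κ * |u| + n * L))
      ≤ tiltMass (μ.restrict (Icc (-κ) κ)) D n u := by
  have h1 : ∫ _ in Icc (-κ) κ, exp (-(κ * |u| + n * L)) ∂μ
      = μ.real (Icc (-κ) κ) * exp (-(κ * |u| + n * L)) := by simp
  rw [← h1]
  refine setIntegral_mono_on (by simp) (integrable_tilt_Icc hD κ n u) measurableSet_Icc
    fun h hh => exp_le_exp.2 ?_
  have h2 : |h * u| ≤ κ * |u| := by
    rw [abs_mul]; exact mul_le_mul_of_nonneg_right (abs_le.2 hh) (abs_nonneg u)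
  have h3 := mul_le_mul_of_nonneg_left (hL h hh) (Nat.cast_nonneg (α := ℝ) n)
  linarith [neg_abs_le (h * u)]

theorem tiltMass_Icc_pos (hD : Continuous D) (hκ : 0 < μ (Icc (-κ) κ)) (n : ℕ) (u : ℝ) :
    0 < tiltMass (μ.restrict (Icc (-κ) κ)) D n u := by
  obtain ⟨L, hL⟩ := (isCompact_Icc (a := -κ) (b := κ)).bddAbove_image hD.continuousOn
  refine lt_of_lt_of_le ?_ (le_tiltMass_Icc hD (fun h hh => hL ⟨h, hh, rfl⟩) n u)
  have : 0 < μ.real (Icc (-κ) κ) := ENNReal.toReal_pos hκ.ne' (measure_ne_top _ _)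
  positivity

theorem tiltMass_Icc_succ (hD : Continuous D) {L : ℝ} (hL : ∀ h ∈ Icc (-κ) κ, D h ≤ L)
    (n : ℕ) (u y : ℝ) :
    exp (-(κ * |y| + L)) * tiltMass (μ.restrict (Icc (-κ) κ)) D n u
      ≤ tiltMass (μ.restrict (Icc (-κ) κ)) D (n + 1) (y + u) := by
  unfold tiltMass
  rw [← integral_const_mul]
  refine setIntegral_mono_on ((integrable_tilt_Icc hD κ n u).const_mul _)
    (integrable_tilt_Icc hD κ (n + 1) _) measurableSet_Icc fun h hh => ?_
  rw [← exp_add]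
  refine exp_le_exp.2 ?_
  have h2 : |h * y| ≤ κ * |y| := by
    rw [abs_mul]; exact mul_le_mul_of_nonneg_right (abs_le.2 hh) (abs_nonneg y)
  push_cast
  linarith [neg_abs_le (h * y), hL h hh]

theorem inv_tiltMass_le (hD : Continuous D) {κ' : ℝ} (hκ : κ' ≤ κ) (hκ' : 0 < μ (Icc (-κ') κ'))
    (n : ℕ) (u : ℝ) :
    (tiltMass (μ.restrict (Icc (-κ) κ)) D n u)⁻¹
      ≤ (tiltMass (μ.restrict (Icc (-κ') κ')) D n u)⁻¹ :=
  inv_anti₀ (tiltMass_Icc_pos hD hκ' n u)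
    (setIntegral_mono_set (integrable_tilt_Icc hD κ n u)
      (Filter.Eventually.of_forall fun _ => (exp_pos _).le)
      (Icc_subset_Icc (neg_le_neg hκ) hκ).eventuallyLE)

theorem inv_tiltMass_le_Icc (hD : Continuous D) (hκ : 0 < μ (Icc (-κ) κ)) (n : ℕ) (u : ℝ) :
    (tiltMass μ D n u)⁻¹ ≤ (tiltMass (μ.restrict (Icc (-κ) κ)) D n u)⁻¹ := by
  have hpos := tiltMass_Icc_pos hD hκ n u
  by_cases hi : Integrable (fun h => exp (h * u - n * D h)) μ
  · exact inv_anti₀ hpos (setIntegral_le_integral hi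
      (Filter.Eventually.of_forall fun _ => (exp_pos _).le))
  · rw [tiltMass, integral_undef hi, inv_zero]
    positivity

theorem tiltMass_bounds_of_tail (hD : Continuous D) {n : ℕ} {u c : ℝ}
    (hc : ∀ᵐ h ∂μ, κ < |h| → h * u - n * D h ≤ -c) :
    tiltMass (μ.restrict (Icc (-κ) κ)) D n u ≤ tiltMass μ D n u ∧
      tiltMass μ D n u ≤ tiltMass (μ.restrict (Icc (-κ) κ)) D n u + exp (-c) * μ.real univ := by
  have hm : AEStronglyMeasurable (fun h => exp (h * u - n * D h)) μ :=
    Continuous.aestronglyMeasurable (by fun_prop)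
  have hb : ∀ᵐ h ∂μ, h ∈ (Icc (-κ) κ)ᶜ → exp (h * u - n * D h) ≤ exp (-c) := by
    filter_upwards [hc] with h hh hmem
    exact exp_le_exp.2 (hh (not_le.1 fun hle => hmem (abs_le.1 hle)))
  have hb' := (ae_restrict_iff' (measurableSet_Icc (a := -κ) (b := κ)).compl).2 hb
  have hi : IntegrableOn (fun h => exp (h * u - n * D h)) (Icc (-κ) κ)ᶜ μ :=
    Integrable.mono' (integrable_const (exp (-c))) hm.restrict (by
      filter_upwards [hb'] with h hh
      rwa [norm_of_nonneg (exp_pos _).le])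
  have hI : Integrable (fun h => exp (h * u - n * D h)) μ := by
    rw [← integrableOn_univ, ← union_compl_self (Icc (-κ) κ)]
    exact (integrable_tilt_Icc hD κ n u).union hi
  refine ⟨setIntegral_le_integral hI (Filter.Eventually.of_forall fun _ => (exp_pos _).le), ?_⟩
  unfold tiltMass
  rw [← integral_add_compl (measurableSet_Icc (a := -κ) (b := κ)) hI]
  gcongr
  calc ∫ h in (Icc (-κ) κ)ᶜ, exp (h * u - n * D h) ∂μ
      ≤ ∫ _ in (Icc (-κ) κ)ᶜ, exp (-c) ∂μ := integral_mono_ae hi (by simp) hb'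
    _ = exp (-c) * μ.real (Icc (-κ) κ)ᶜ := by simp [mul_comm]
    _ ≤ exp (-c) * μ.real univ := by
      exact mul_le_mul_of_nonneg_left (measureReal_mono (subset_univ _)) (exp_pos _).le

theorem tiltMass_Icc_le (hD : Continuous D) (hD0 : ∀ h ∈ Icc (-κ) κ, 0 ≤ D h) (n : ℕ) (u : ℝ) :
    tiltMass (μ.restrict (Icc (-κ) κ)) D n u ≤ exp (κ * |u|) * μ.real univ := by
  calc tiltMass (μ.restrict (Icc (-κ) κ)) D n u
      ≤ ∫ _ in Icc (-κ) κ, exp (κ * |u|) ∂μ := by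
        refine setIntegral_mono_on (integrable_tilt_Icc hD κ n u) (by simp) measurableSet_Icc
          fun h hh => exp_le_exp.2 ?_
        have h2 : |h * u| ≤ κ * |u| := by
          rw [abs_mul]; exact mul_le_mul_of_nonneg_right (abs_le.2 hh) (abs_nonneg u)
        have h3 := mul_nonneg (Nat.cast_nonneg (α := ℝ) n) (hD0 h hh)
        linarith [le_abs_self (h * u)]
    _ = exp (κ * |u|) * μ.real (Icc (-κ) κ) := by simp [mul_comm]
    _ ≤ exp (κ * |u|) * μ.real univ := by
      exact mul_le_mul_of_nonneg_left (measureReal_mono (subset_univ _)) (exp_pos _).le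

end TiltMass

section Moments

variable {X : Type*} [MeasurableSpace X] {P : Measure X} [IsProbabilityMeasure P] {Y : X → ℝ}

theorem lintegral_exp_mul_sum (hY : Measurable Y) {t d : ℝ}
    (h : ∫⁻ x, ENNReal.ofReal (exp (t * Y x)) ∂P = ENNReal.ofReal (exp d)) (n : ℕ) :
    ∫⁻ s : Fin n → X, ENNReal.ofReal (exp (t * ∑ i, Y (s i))) ∂(Measure.pi fun _ => P)
      = ENNReal.ofReal (exp (n * d)) := by
  have h1 (s : Fin n → X) : ENNReal.ofReal (exp (t * ∑ i, Y (s i)))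
      = ∏ i, ENNReal.ofReal (exp (t * Y (s i))) := by
    rw [Finset.mul_sum, exp_sum, ENNReal.ofReal_prod_of_nonneg fun _ _ => (exp_pos _).le]
  simp_rw [h1]
  rw [lintegral_pi_fin_prod P (f := fun _ x => ENNReal.ofReal (exp (t * Y x)))
    fun _ => by fun_prop]
  simp [h, exp_nat_mul, ENNReal.ofReal_pow (exp_pos d).le]

theorem lintegral_exp_mul_abs_sum_le (hY : Measurable Y) {w d₁ d₂ d : ℝ}
    (h₁ : ∫⁻ x, ENNReal.ofReal (exp (w * Y x)) ∂P = ENNReal.ofReal (exp d₁))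
    (h₂ : ∫⁻ x, ENNReal.ofReal (exp (-w * Y x)) ∂P = ENNReal.ofReal (exp d₂))
    (hd₁ : d₁ ≤ d) (hd₂ : d₂ ≤ d) (n : ℕ) :
    ∫⁻ s : Fin n → X, ENNReal.ofReal (exp (w * |∑ i, Y (s i)|)) ∂(Measure.pi fun _ => P)
      ≤ ENNReal.ofReal (2 * exp (n * d)) := by
  calc ∫⁻ s : Fin n → X, ENNReal.ofReal (exp (w * |∑ i, Y (s i)|)) ∂(Measure.pi fun _ => P)
      ≤ ∫⁻ s : Fin n → X, (ENNReal.ofReal (exp (w * ∑ i, Y (s i)))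
          + ENNReal.ofReal (exp (-w * ∑ i, Y (s i)))) ∂(Measure.pi fun _ => P) := by
        refine lintegral_mono fun s => ?_
        rcases abs_cases (∑ i, Y (s i)) with ⟨h, -⟩ | ⟨h, -⟩
        · rw [h]; exact le_self_add
        · rw [h, mul_neg, ← neg_mul]; exact le_add_self
    _ = ENNReal.ofReal (exp (n * d₁)) + ENNReal.ofReal (exp (n * d₂)) := by
        rw [lintegral_add_left (by fun_prop), lintegral_exp_mul_sum hY h₁,
          lintegral_exp_mul_sum hY h₂]
    _ ≤ ENNReal.ofReal (2 * exp (n * d)) := by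
        rw [← ENNReal.ofReal_add (exp_pos _).le (exp_pos _).le, two_mul]
        gcongr

theorem setLIntegral_exp_mul_abs_sum_le (hY : Measurable Y) {w d₁ d₂ d : ℝ} (hw : 0 ≤ w)
    (h₁ : ∫⁻ x, ENNReal.ofReal (exp (2 * w * Y x)) ∂P = ENNReal.ofReal (exp d₁))
    (h₂ : ∫⁻ x, ENNReal.ofReal (exp (-(2 * w) * Y x)) ∂P = ENNReal.ofReal (exp d₂))
    (hd₁ : d₁ ≤ d) (hd₂ : d₂ ≤ d) (δ : ℝ) (n : ℕ) :
    ∫⁻ s in {s : Fin n → X | n * δ < |∑ i, Y (s i)|},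
        ENNReal.ofReal (exp (w * |∑ i, Y (s i)|)) ∂(Measure.pi fun _ => P)
      ≤ ENNReal.ofReal (2 * exp (n * (d - w * δ))) := by
  have hmeas : MeasurableSet {s : Fin n → X | n * δ < |∑ i, Y (s i)|} :=
    measurableSet_lt measurable_const (by fun_prop)
  calc ∫⁻ s in {s : Fin n → X | n * δ < |∑ i, Y (s i)|},
        ENNReal.ofReal (exp (w * |∑ i, Y (s i)|)) ∂(Measure.pi fun _ => P)
      ≤ ∫⁻ s in {s : Fin n → X | n * δ < |∑ i, Y (s i)|}, ENNReal.ofReal (exp (-(n * (w * δ))))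
          * ENNReal.ofReal (exp (2 * w * |∑ i, Y (s i)|)) ∂(Measure.pi fun _ => P) := by
        refine setLIntegral_mono' hmeas fun s hs => ?_
        rw [← ENNReal.ofReal_mul (exp_pos _).le, ← exp_add]
        refine ENNReal.ofReal_le_ofReal (exp_le_exp.2 ?_)
        have hs' : n * δ < |∑ i, Y (s i)| := hs
        have := mul_le_mul_of_nonneg_left hs'.le hw
        linarith
    _ ≤ ∫⁻ s : Fin n → X, ENNReal.ofReal (exp (-(n * (w * δ))))
          * ENNReal.ofReal (exp (2 * w * |∑ i, Y (s i)|)) ∂(Measure.pi fun _ => P) :=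
        setLIntegral_le_lintegral _ _
    _ ≤ ENNReal.ofReal (exp (-(n * (w * δ)))) * ENNReal.ofReal (2 * exp (n * d)) := by
        rw [lintegral_const_mul _ (by fun_prop)]
        gcongr
        exact lintegral_exp_mul_abs_sum_le hY h₁ h₂ hd₁ hd₂ n
    _ = ENNReal.ofReal (2 * exp (n * (d - w * δ))) := by
        rw [← ENNReal.ofReal_mul (exp_pos _).le, mul_left_comm, ← exp_add]
        congr 3
        ring

theorem lintegral_exp_mul_abs_le_interpolate (hY : Measurable Y) {w κ b : ℝ}
    (hw : 0 < w) (hκ : 0 ≤ κ) (hκw : κ ≤ w) (hb : 0 ≤ b)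
    (h : ∫⁻ x, ENNReal.ofReal (exp (w * |Y x|)) ∂P ≤ ENNReal.ofReal b) :
    ∫⁻ x, ENNReal.ofReal (exp (κ * |Y x|)) ∂P ≤ ENNReal.ofReal (1 + κ / w * b) := by
  have hθ : 0 ≤ κ / w := by positivity
  have hθ1 : κ / w ≤ 1 := (div_le_one hw).2 hκw
  calc ∫⁻ x, ENNReal.ofReal (exp (κ * |Y x|)) ∂P
      ≤ ∫⁻ x, (1 + ENNReal.ofReal (κ / w) * ENNReal.ofReal (exp (w * |Y x|))) ∂P := by
        refine lintegral_mono fun x => ?_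
        rw [← ENNReal.ofReal_one, ← ENNReal.ofReal_mul hθ,
          ← ENNReal.ofReal_add zero_le_one (by positivity)]
        refine ENNReal.ofReal_le_ofReal ?_
        have hc := convexOn_exp.2 (mem_univ 0) (mem_univ (w * |Y x|)) (sub_nonneg.2 hθ1) hθ
          (by ring)
        have e : κ / w * (w * |Y x|) = κ * |Y x| := by field_simp
        simp only [smul_eq_mul, mul_zero, zero_add, exp_zero, mul_one, e] at hc
        linarith
    _ ≤ ENNReal.ofReal (1 + κ / w * b) := by
        rw [lintegral_add_left measurable_const, lintegral_const_mul _ (by fun_prop),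
          ENNReal.ofReal_add zero_le_one (by positivity), ENNReal.ofReal_mul hθ]
        simp only [lintegral_const, measure_univ, mul_one, ENNReal.ofReal_one]
        gcongr

end Moments

section TiltModel

open Filter Topology

variable {X : Type*} [MeasurableSpace X]

/-- A one-parameter exponential family centred at parameter `0`: under `P`, the statistic `Y` has
logarithmic moment generating function `D` on the parameter set `I`, and `μ` is a prior for the
natural parameter that charges every neighbourhood of `0`. -/
structure IsTiltModel (P : Measure X) (Y : X → ℝ) (μ : Measure ℝ) (D : ℝ → ℝ) (I : Set ℝ) :
    Prop where
  measurable_stat : Measurable Y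
  continuous_logMGF : Continuous D
  logMGF_zero : D 0 = 0
  hasDerivAt_logMGF : HasDerivAt D 0 0
  strictConvexOn : StrictConvexOn ℝ I D
  mem_nhds : I ∈ 𝓝 0
  mgf_eq : ∀ t ∈ I, ∫⁻ x, ENNReal.ofReal (exp (t * Y x)) ∂P = ENNReal.ofReal (exp (D t))
  ae_mem : ∀ᵐ h ∂μ, h ∈ I
  prior_pos : ∀ κ > 0, 0 < μ (Icc (-κ) κ)

/-- The expectation of `1 / M (∑ i, Y (s i))` over `n` independent draws from `P`. -/
noncomputable def expectedInv (P : Measure X) (Y : X → ℝ) (M : ℝ → ℝ)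
    (n : ℕ) : ℝ≥0∞ :=
  ∫⁻ s : Fin n → X, ENNReal.ofReal (M (∑ i, Y (s i)))⁻¹ ∂(Measure.pi fun _ => P)

namespace IsTiltModel

variable {P : Measure X} {Y : X → ℝ} {μ : Measure ℝ} {D : ℝ → ℝ} {I : Set ℝ}

theorem logMGF_pos (H : IsTiltModel P Y μ D I) {h : ℝ} (hI : h ∈ I) (h0 : h ≠ 0) : 0 < D h := by
  have h0I : (0 : ℝ) ∈ I := mem_of_mem_nhds H.mem_nhds
  rcases lt_or_gt_of_ne h0 with hneg | hpos
  · have := H.strictConvexOn.slope_lt_of_hasDerivAt hI h0I hneg H.hasDerivAt_logMGF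
    rw [slope_def_field, H.logMGF_zero, div_lt_iff₀ (by linarith)] at this
    linarith
  · have := H.strictConvexOn.lt_slope_of_hasDerivAt h0I hI hpos H.hasDerivAt_logMGF
    rw [slope_def_field, H.logMGF_zero, lt_div_iff₀ (by linarith)] at this
    linarith

theorem logMGF_nonneg (H : IsTiltModel P Y μ D I) {h : ℝ} (hI : h ∈ I) : 0 ≤ D h := by
  rcases eq_or_ne h 0 with rfl | h0
  · exact H.logMGF_zero.ge
  · exact (H.logMGF_pos hI h0).le

theorem eventually_Icc_subset (H : IsTiltModel P Y μ D I) :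
    ∀ᶠ κ in 𝓝[>] (0 : ℝ), Icc (-κ) κ ⊆ I := by
  obtain ⟨r, hr, hrI⟩ := Metric.nhds_basis_closedBall.mem_iff.1 H.mem_nhds
  filter_upwards [Ioc_mem_nhdsGT hr] with κ hκ
  rw [Real.closedBall_eq_Icc, zero_sub, zero_add] at hrI
  exact (Icc_subset_Icc (neg_le_neg hκ.2) hκ.2).trans hrI

theorem eventually_logMGF_le (H : IsTiltModel P Y μ D I) {L : ℝ} (hL : 0 < L) :
    ∀ᶠ κ in 𝓝[>] (0 : ℝ), ∀ h ∈ Icc (-κ) κ, D h ≤ L := by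
  have h1 : ∀ᶠ h in 𝓝 (0 : ℝ), D h < L :=
    H.continuous_logMGF.continuousAt.eventually_lt_const (by rwa [H.logMGF_zero])
  obtain ⟨r, hr, hrI⟩ := Metric.nhds_basis_closedBall.mem_iff.1 h1
  rw [Real.closedBall_eq_Icc, zero_sub, zero_add] at hrI
  filter_upwards [Ioc_mem_nhdsGT hr] with κ hκ h hh
  exact (hrI (Icc_subset_Icc (neg_le_neg hκ.2) hκ.2 hh)).le

theorem eventually_logMGF_le_mul_abs (H : IsTiltModel P Y μ D I) {a : ℝ} (ha : 0 < a) :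
    ∀ᶠ w in 𝓝 (0 : ℝ), D w ≤ a * |w| := by
  have h1 := (hasDerivAt_iff_isLittleO.1 H.hasDerivAt_logMGF).def ha
  filter_upwards [h1] with w hw
  simp only [H.logMGF_zero, sub_zero, smul_zero, norm_eq_abs] at hw
  exact (le_abs_self _).trans hw

theorem exists_linear_growth (H : IsTiltModel P Y μ D I) {κ : ℝ} (hκ : 0 < κ)
    (hκI : Icc (-κ) κ ⊆ I) : ∃ γ > 0, ∀ h ∈ I, κ < |h| → γ * |h| ≤ D h := by
  have h0I : (0 : ℝ) ∈ I := mem_of_mem_nhds H.mem_nhds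
  have hp : κ ∈ I := hκI ⟨by linarith, le_rfl⟩
  have hm : -κ ∈ I := hκI ⟨le_rfl, by linarith⟩
  have hpp := H.logMGF_pos hp hκ.ne'
  have hmm := H.logMGF_pos hm (neg_ne_zero.2 hκ.ne')
  refine ⟨min (D κ) (D (-κ)) / κ, by positivity, fun h hI hh => ?_⟩
  have hpos : 0 < |h| := hκ.trans hh
  have hle : κ / |h| ≤ 1 := (div_le_one hpos).2 hh.le
  have hc := H.strictConvexOn.convexOn.2 hI h0I (by positivity : 0 ≤ κ / |h|)
    (sub_nonneg.2 hle) (by ring)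
  simp only [smul_eq_mul, mul_zero, add_zero, H.logMGF_zero] at hc
  have hmin : min (D κ) (D (-κ)) ≤ κ / |h| * D h := by
    rcases abs_cases h with ⟨e, -⟩ | ⟨e, -⟩
    · rw [e] at hc hpos ⊢
      rw [div_mul_cancel₀ _ hpos.ne'] at hc
      exact (min_le_left _ _).trans hc
    · rw [e] at hc hpos ⊢
      have : κ / -h * h = -κ := by
        have : h ≠ 0 := by rintro rfl; simp at hpos
        field_simp
      rw [this] at hc
      exact (min_le_right _ _).trans hc
  rw [div_mul_eq_mul_div, div_le_iff₀ hκ]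
  rw [div_mul_eq_mul_div, le_div_iff₀ hpos] at hmin
  linarith

theorem measurable_inv_tiltMass (H : IsTiltModel P Y μ D I) (ρ : Measure ℝ) [IsFiniteMeasure ρ]
    (n : ℕ) : Measurable fun s : Fin n → X =>
      ENNReal.ofReal (tiltMass ρ D n (∑ i, Y (s i)))⁻¹ := by
  have h1 := H.measurable_stat
  have h2 : Measurable fun s : Fin n → X => tiltMass ρ D n (∑ i, Y (s i)) :=
    (measurable_tiltMass H.continuous_logMGF n).comp (by fun_prop)
  exact h2.inv.ennreal_ofReal

/-- On the event that the empirical mean of `Y` is small, the posterior concentrates near `0`. -/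
theorem exists_concentration [IsProbabilityMeasure μ] (H : IsTiltModel P Y μ D I) {κ : ℝ}
    (hκ : 0 < κ)
    (hκI : Icc (-κ) κ ⊆ I) :
    ∃ δ > 0, ∀ ε > 0, ∀ᶠ n : ℕ in atTop, ∀ u : ℝ, |u| ≤ n * δ →
      tiltMass (μ.restrict (Icc (-κ) κ)) D n u ≤ tiltMass μ D n u ∧
      tiltMass μ D n u ≤ (1 + ε) * tiltMass (μ.restrict (Icc (-κ) κ)) D n u := by
  obtain ⟨γ, hγ, hgrow⟩ := H.exists_linear_growth hκ hκI
  set c := κ * (γ / 2) with hc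
  have hc0 : 0 < c := by positivity
  obtain ⟨κ', ⟨⟨hL, hκ'⟩, hκ'γ⟩, hκ'0⟩ := (((H.eventually_logMGF_le (L := c / 4)
    (by positivity)).and (Ioc_mem_nhdsGT hκ)).and
    (Ioc_mem_nhdsGT (by positivity : 0 < κ / 4))).and
    self_mem_nhdsWithin |>.exists
  have hκ'0 : 0 < κ' := hκ'0
  have hq : 0 < μ.real (Icc (-κ') κ') :=
    ENNReal.toReal_pos (H.prior_pos κ' hκ'0).ne' (measure_ne_top _ _)
  set q := μ.real (Icc (-κ') κ')
  refine ⟨γ / 2, by positivity, fun ε hε => ?_⟩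
  have hlim : Tendsto (fun n : ℕ => exp (-(n * (c / 2)))) atTop (𝓝 0) :=
    tendsto_exp_neg_atTop_nhds_zero.comp
      (tendsto_natCast_atTop_atTop.atTop_mul_const (by positivity))
  filter_upwards [hlim.eventually_le_const (by positivity : 0 < ε * q)] with n hn u hu
  obtain ⟨hb1, hb2⟩ := tiltMass_bounds_of_tail (μ := μ) H.continuous_logMGF (n := n) (u := u)
    (κ := κ) (c := n * c) (by
      filter_upwards [H.ae_mem] with h hI hh
      have h1 := mul_le_mul_of_nonneg_left (hgrow h hI hh) (Nat.cast_nonneg (α := ℝ) n)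
      have h2 : h * u ≤ |h| * (n * (γ / 2)) := (le_abs_self _).trans (by
        rw [abs_mul]; gcongr)
      have h3 : n * (γ / 2) * κ ≤ n * (γ / 2) * |h| := by gcongr
      rw [hc]
      nlinarith)
  refine ⟨hb1, hb2.trans ?_⟩
  have h4 := le_tiltMass_Icc (μ := μ) H.continuous_logMGF hL n u
  have h5 := inv_tiltMass_le (μ := μ) H.continuous_logMGF hκ'.2 (H.prior_pos κ' hκ'0) n u
  rw [inv_le_inv₀ (tiltMass_Icc_pos H.continuous_logMGF (H.prior_pos κ hκ) n u)
    (tiltMass_Icc_pos H.continuous_logMGF (H.prior_pos κ' hκ'0) n u)] at h5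
  have h6 : exp (-(n * (c / 2))) ≤ exp (-(κ' * |u| + n * (c / 4))) := by
    refine exp_le_exp.2 ?_
    have : κ' * |u| ≤ κ / 4 * (n * (γ / 2)) := mul_le_mul hκ'γ.2 hu (abs_nonneg u) (by positivity)
    rw [hc] at *
    nlinarith
  have h7 : exp (-(n * c)) = exp (-(n * (c / 2))) * exp (-(n * (c / 2))) := by
    rw [← exp_add]; congr 1; ring
  have h8 : exp (-(n * c)) ≤ ε * (q * exp (-(κ' * |u| + n * (c / 4)))) := by
    rw [h7, ← mul_assoc]; gcongr
  have h9 := mul_le_mul_of_nonneg_left (h4.trans h5) hε.le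
  rw [probReal_univ]
  linarith

variable [IsProbabilityMeasure P]

theorem exists_tail_bound (H : IsTiltModel P Y μ D I) {δ : ℝ} (hδ : 0 < δ) :
    ∃ w > 0, ∃ r > 0, ∀ n : ℕ,
      ∫⁻ s in {s : Fin n → X | n * δ < |∑ i, Y (s i)|},
        ENNReal.ofReal (exp (w * |∑ i, Y (s i)|)) ∂(Measure.pi fun _ => P)
        ≤ ENNReal.ofReal (2 * exp (-(n * r))) := by
  obtain ⟨r, hr, hrD⟩ := Metric.nhds_basis_closedBall.mem_iff.1
    (H.eventually_logMGF_le_mul_abs (a := δ / 4) (by positivity))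
  rw [Real.closedBall_eq_Icc, zero_sub, zero_add] at hrD
  obtain ⟨w, ⟨hwI, hwr⟩, hw⟩ := ((H.eventually_Icc_subset.and (Ioc_mem_nhdsGT hr)).and
    self_mem_nhdsWithin).exists
  have hw : 0 < w := hw
  have hp : w ∈ Icc (-w) w := ⟨by linarith, le_rfl⟩
  have hm : -w ∈ Icc (-w) w := ⟨le_rfl, by linarith⟩
  have hsub : Icc (-w) w ⊆ Icc (-r) r := Icc_subset_Icc (neg_le_neg hwr.2) hwr.2
  have e1 : D w ≤ δ / 4 * |w| := hrD (hsub hp)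
  have e2 : D (-w) ≤ δ / 4 * |-w| := hrD (hsub hm)
  rw [abs_of_pos hw] at e1
  rw [abs_neg, abs_of_pos hw] at e2
  refine ⟨w / 2, by positivity, δ / 4 * w, by positivity, fun n => ?_⟩
  have := setLIntegral_exp_mul_abs_sum_le (P := P) H.measurable_stat (w := w / 2) (by positivity)
    (by rw [mul_div_cancel₀ w two_ne_zero]; exact H.mgf_eq w (hwI hp))
    (by rw [mul_div_cancel₀ w two_ne_zero]; exact H.mgf_eq (-w) (hwI hm)) e1 e2 δ n
  refine this.trans_eq ?_
  congr 3
  ring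

theorem exists_one_step_bound (H : IsTiltModel P Y μ D I) {a : ℝ} (ha : 1 < a) :
    ∃ κ > 0, Icc (-κ) κ ⊆ I ∧ ∃ L, (∀ h ∈ Icc (-κ) κ, D h ≤ L) ∧
      ENNReal.ofReal (exp L) * (∫⁻ x, ENNReal.ofReal (exp (κ * |Y x|)) ∂P)
        ≤ ENNReal.ofReal a := by
  obtain ⟨w, ⟨hL, hwI⟩, hw⟩ := ((H.eventually_logMGF_le one_pos).and
    H.eventually_Icc_subset).and self_mem_nhdsWithin |>.exists
  have hw : 0 < w := hw
  have hp : w ∈ Icc (-w) w := ⟨by linarith, le_rfl⟩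
  have hm : -w ∈ Icc (-w) w := ⟨le_rfl, by linarith⟩
  have hmom : ∫⁻ x, ENNReal.ofReal (exp (w * |Y x|)) ∂P ≤ ENNReal.ofReal (2 * exp 1) := by
    have h1 := lintegral_exp_mul_abs_sum_le H.measurable_stat (H.mgf_eq w (hwI hp))
      (H.mgf_eq (-w) (hwI hm)) (hL w hp) (hL (-w) hm) 1
    have hY := H.measurable_stat
    rw [lintegral_pi_fin_succ P (by fun_prop)] at h1
    simpa using h1
  obtain ⟨L, hLa, hL0⟩ : ∃ L : ℝ, exp L < a ∧ 0 < L := by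
    have h1 : ∀ᶠ L in 𝓝 (0 : ℝ), exp L < a :=
      continuous_exp.continuousAt.eventually_lt_const (by simpa)
    exact ((h1.filter_mono nhdsWithin_le_nhds).and
      (self_mem_nhdsWithin : Ioi (0 : ℝ) ∈ 𝓝[>] 0)).exists
  have hcont : ContinuousAt (fun κ : ℝ => exp L * (1 + κ / w * (2 * exp 1))) 0 := by fun_prop
  have h2 := hcont.eventually_lt_const (u := a) (by simpa)
  obtain ⟨κ, ⟨⟨hLκ, hκw⟩, hκa⟩, hκ⟩ := (((H.eventually_logMGF_le hL0).and
    (Ioc_mem_nhdsGT hw)).and (h2.filter_mono nhdsWithin_le_nhds)).and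
    self_mem_nhdsWithin |>.exists
  have hκ : 0 < κ := hκ
  refine ⟨κ, hκ, (Icc_subset_Icc (neg_le_neg hκw.2) hκw.2).trans hwI, L, hLκ, ?_⟩
  calc _ ≤ ENNReal.ofReal (exp L) * ENNReal.ofReal (1 + κ / w * (2 * exp 1)) := by
        gcongr
        exact lintegral_exp_mul_abs_le_interpolate H.measurable_stat hw hκ.le hκw.2
          (by positivity) hmom
    _ ≤ ENNReal.ofReal a := by
        rw [← ENNReal.ofReal_mul (exp_pos _).le]
        exact ENNReal.ofReal_le_ofReal hκa.le

variable [IsProbabilityMeasure μ]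

theorem eventually_le_expectedInv (H : IsTiltModel P Y μ D I) {r : ℝ} (hr : 0 < r) :
    ∀ᶠ n : ℕ in atTop,
      ENNReal.ofReal (1 / 4 * exp (-(n * r))) ≤ expectedInv P Y (tiltMass μ D n) n := by
  obtain ⟨κ, hκI, hκ⟩ := (H.eventually_Icc_subset.and self_mem_nhdsWithin).exists
  have hκ : 0 < κ := hκ
  obtain ⟨δ, hδ, hconc⟩ := H.exists_concentration hκ hκI
  set δ' := min δ (r / κ)
  have hδ' : 0 < δ' := by positivity
  obtain ⟨w, hw, a, ha, htail⟩ := H.exists_tail_bound hδ'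
  have hlim : Tendsto (fun n : ℕ => 2 * exp (-(n * a))) atTop (𝓝 (2 * 0)) :=
    (tendsto_exp_neg_atTop_nhds_zero.comp
      (tendsto_natCast_atTop_atTop.atTop_mul_const ha)).const_mul 2
  filter_upwards [hlim.eventually_le_const (by norm_num : 2 * 0 < (1 / 2 : ℝ)),
    hconc 1 one_pos] with n hn hcn
  set G := {s : Fin n → X | n * δ' < |∑ i, Y (s i)|}
  have hG : MeasurableSet G := by
    have := H.measurable_stat
    exact measurableSet_lt measurable_const (by fun_prop)
  have hPG : (Measure.pi fun _ => P) G ≤ ENNReal.ofReal (1 / 2) := by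
    calc (Measure.pi fun _ => P) G = ∫⁻ s in G, 1 ∂(Measure.pi fun _ => P) := by simp
      _ ≤ ∫⁻ s in G, ENNReal.ofReal (exp (w * |∑ i, Y (s i)|)) ∂(Measure.pi fun _ => P) := by
        refine lintegral_mono fun s => ?_
        rw [← ENNReal.ofReal_one]
        exact ENNReal.ofReal_le_ofReal (one_le_exp (by positivity))
      _ ≤ ENNReal.ofReal (1 / 2) := (htail n).trans (ENNReal.ofReal_le_ofReal hn)
  have hPGc : ENNReal.ofReal (1 / 2) ≤ (Measure.pi fun _ => P) Gᶜ := by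
    rw [prob_compl_eq_one_sub hG]
    refine le_trans ?_ (tsub_le_tsub_left hPG 1)
    rw [← ENNReal.ofReal_one, ← ENNReal.ofReal_sub _ (by norm_num)]
    norm_num
  calc ENNReal.ofReal (1 / 4 * exp (-(n * r)))
      = ENNReal.ofReal (1 / 2 * exp (-(n * r))) * ENNReal.ofReal (1 / 2) := by
        rw [← ENNReal.ofReal_mul (by positivity)]; congr 1; ring
    _ ≤ ENNReal.ofReal (1 / 2 * exp (-(n * r))) * (Measure.pi fun _ => P) Gᶜ := by gcongr
    _ = ∫⁻ s in Gᶜ, ENNReal.ofReal (1 / 2 * exp (-(n * r))) ∂(Measure.pi fun _ => P) := by simp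
    _ ≤ ∫⁻ s in Gᶜ, ENNReal.ofReal (tiltMass μ D n (∑ i, Y (s i)))⁻¹
          ∂(Measure.pi fun _ => P) := by
        refine setLIntegral_mono' hG.compl fun s hs => ENNReal.ofReal_le_ofReal ?_
        have hs' : |∑ i, Y (s i)| ≤ n * δ' := not_lt.1 hs
        obtain ⟨h1, h2⟩ := hcn _ (hs'.trans (by gcongr; exact min_le_left _ _))
        have h3 := tiltMass_Icc_le (μ := μ) H.continuous_logMGF
          (fun h hh => H.logMGF_nonneg (hκI hh)) n (∑ i, Y (s i))
        have h4 : κ * |∑ i, Y (s i)| ≤ n * r := by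
          calc κ * |∑ i, Y (s i)| ≤ κ * (n * (r / κ)) := by
                gcongr; exact hs'.trans (by gcongr; exact min_le_right _ _)
            _ = n * r := by field_simp
        have h5 := exp_le_exp.2 h4
        have hpos := tiltMass_Icc_pos (μ := μ) H.continuous_logMGF (H.prior_pos κ hκ) n
          (∑ i, Y (s i))
        rw [probReal_univ, mul_one] at h3
        rw [le_inv_comm₀ (by positivity) (hpos.trans_le h1), mul_inv, ← exp_neg, neg_neg]
        norm_num at h2 ⊢
        linarith
    _ ≤ expectedInv P Y (tiltMass μ D n) n := setLIntegral_le_lintegral _ _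

theorem exists_bad_event_bound (H : IsTiltModel P Y μ D I) {κ δ : ℝ} (hκ : 0 < κ)
    (hδ : 0 < δ) : ∃ r > 0, ∃ C > 0, ∀ n : ℕ,
      ∫⁻ s in {s : Fin n → X | n * δ < |∑ i, Y (s i)|},
        ENNReal.ofReal (tiltMass (μ.restrict (Icc (-κ) κ)) D n (∑ i, Y (s i)))⁻¹
          ∂(Measure.pi fun _ => P)
        ≤ ENNReal.ofReal (C * exp (-(n * r))) := by
  obtain ⟨w, hw, r, hr, htail⟩ := H.exists_tail_bound hδ
  obtain ⟨κ', ⟨⟨hL, hκ'⟩, hκ'w⟩, hκ'0⟩ := (((H.eventually_logMGF_le (L := r / 2)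
    (by positivity)).and (Ioc_mem_nhdsGT hκ)).and (Ioc_mem_nhdsGT hw)).and
    self_mem_nhdsWithin |>.exists
  have hκ'0 : 0 < κ' := hκ'0
  have hq : 0 < μ.real (Icc (-κ') κ') :=
    ENNReal.toReal_pos (H.prior_pos κ' hκ'0).ne' (measure_ne_top _ _)
  set q := μ.real (Icc (-κ') κ')
  have hY := H.measurable_stat
  refine ⟨r / 2, by positivity, 2 * q⁻¹, by positivity, fun n => ?_⟩
  calc _ ≤ ∫⁻ s in {s : Fin n → X | n * δ < |∑ i, Y (s i)|},
        ENNReal.ofReal (q⁻¹ * exp (n * (r / 2))) * ENNReal.ofReal (exp (w * |∑ i, Y (s i)|))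
          ∂(Measure.pi fun _ => P) := by
        refine lintegral_mono fun s => ?_
        rw [← ENNReal.ofReal_mul (by positivity)]
        refine ENNReal.ofReal_le_ofReal ?_
        refine (inv_tiltMass_le (μ := μ) H.continuous_logMGF hκ'.2
          (H.prior_pos κ' hκ'0) n _).trans ?_
        refine (inv_anti₀ (by positivity) (le_tiltMass_Icc (μ := μ) H.continuous_logMGF hL n
          _)).trans ?_
        rw [mul_inv, ← exp_neg, neg_neg, mul_assoc, ← exp_add]
        have := mul_le_mul_of_nonneg_right hκ'w.2 (abs_nonneg (∑ i, Y (s i)))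
        exact mul_le_mul_of_nonneg_left (exp_le_exp.2 (by linarith)) (by positivity)
    _ ≤ ENNReal.ofReal (q⁻¹ * exp (n * (r / 2))) * ENNReal.ofReal (2 * exp (-(n * r))) := by
        rw [lintegral_const_mul _ (by fun_prop)]
        gcongr
        exact htail n
    _ = ENNReal.ofReal (2 * q⁻¹ * exp (-(n * (r / 2)))) := by
        rw [← ENNReal.ofReal_mul (by positivity)]
        have : exp (-(n * (r / 2))) = exp (n * (r / 2)) * exp (-(n * r)) := by
          rw [← exp_add]; congr 1; ring
        rw [this]
        congr 1
        ring

theorem eventually_expectedInv_Icc_le (H : IsTiltModel P Y μ D I) {κ ε : ℝ} (hκ : 0 < κ)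
    (hκI : Icc (-κ) κ ⊆ I) (hε : 0 < ε) :
    ∀ᶠ n : ℕ in atTop, expectedInv P Y (tiltMass (μ.restrict (Icc (-κ) κ)) D n) n
      ≤ ENNReal.ofReal (1 + ε) * expectedInv P Y (tiltMass μ D n) n := by
  obtain ⟨δ, hδ, hconc⟩ := H.exists_concentration hκ hκI
  obtain ⟨r, hr, C, hC, hbad⟩ := H.exists_bad_event_bound hκ hδ
  have hlim : Tendsto (fun n : ℕ => C * exp (-(n * (r / 2)))) atTop (𝓝 (C * 0)) :=
    (tendsto_exp_neg_atTop_nhds_zero.comp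
      (tendsto_natCast_atTop_atTop.atTop_mul_const (by positivity))).const_mul C
  filter_upwards [hconc (ε / 2) (by positivity), H.eventually_le_expectedInv (r := r / 2)
    (by positivity), hlim.eventually_le_const (by simpa using by positivity :
      C * 0 < ε / 2 * (1 / 4))] with n hcn hlow hn
  set G := {s : Fin n → X | n * δ < |∑ i, Y (s i)|}
  have hG : MeasurableSet G := by
    have := H.measurable_stat
    exact measurableSet_lt measurable_const (by fun_prop)
  have hgood : ∫⁻ s in Gᶜ,
      ENNReal.ofReal (tiltMass (μ.restrict (Icc (-κ) κ)) D n (∑ i, Y (s i)))⁻¹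
        ∂(Measure.pi fun _ => P)
      ≤ ENNReal.ofReal (1 + ε / 2) * expectedInv P Y (tiltMass μ D n) n := by
    unfold expectedInv
    rw [← lintegral_const_mul _ (H.measurable_inv_tiltMass μ n)]
    refine (setLIntegral_mono' hG.compl fun s hs => ?_).trans (setLIntegral_le_lintegral _ _)
    rw [← ENNReal.ofReal_mul (by positivity)]
    refine ENNReal.ofReal_le_ofReal ?_
    obtain ⟨h1, h2⟩ := hcn _ (not_lt.1 hs)
    have hpos := tiltMass_Icc_pos (μ := μ) H.continuous_logMGF (H.prior_pos κ hκ) n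
      (∑ i, Y (s i))
    rw [← div_eq_mul_inv, inv_eq_one_div, div_le_div_iff₀ hpos (hpos.trans_le h1), one_mul]
    exact h2
  have hbad' : ENNReal.ofReal (C * exp (-(n * r)))
      ≤ ENNReal.ofReal (ε / 2) * expectedInv P Y (tiltMass μ D n) n := by
    refine le_trans ?_ (mul_le_mul_right hlow _)
    rw [← ENNReal.ofReal_mul (by positivity)]
    refine ENNReal.ofReal_le_ofReal ?_
    have : exp (-(n * r)) = exp (-(n * (r / 2))) * exp (-(n * (r / 2))) := by
      rw [← exp_add]; congr 1; ring
    rw [this, ← mul_assoc, ← mul_assoc]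
    gcongr
  calc expectedInv P Y (tiltMass (μ.restrict (Icc (-κ) κ)) D n) n
      = _ := (lintegral_add_compl _ hG).symm
    _ ≤ ENNReal.ofReal (ε / 2) * expectedInv P Y (tiltMass μ D n) n
        + ENNReal.ofReal (1 + ε / 2) * expectedInv P Y (tiltMass μ D n) n :=
        add_le_add ((hbad n).trans hbad') hgood
    _ = ENNReal.ofReal (1 + ε) * expectedInv P Y (tiltMass μ D n) n := by
        rw [← add_mul, ← ENNReal.ofReal_add (by positivity) (by positivity)]
        congr 2
        ring

theorem expectedInv_succ_le (H : IsTiltModel P Y μ D I) {κ L : ℝ} (hκ : 0 < κ)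
    (hL : ∀ h ∈ Icc (-κ) κ, D h ≤ L) (n : ℕ) :
    expectedInv P Y (tiltMass μ D (n + 1)) (n + 1)
      ≤ ENNReal.ofReal (exp L) * (∫⁻ x, ENNReal.ofReal (exp (κ * |Y x|)) ∂P)
        * expectedInv P Y (tiltMass (μ.restrict (Icc (-κ) κ)) D n) n := by
  have hY := H.measurable_stat
  have hκμ := H.prior_pos κ hκ
  rw [← lintegral_const_mul _ (by fun_prop), ← lintegral_mul_const _ (by fun_prop)]
  unfold expectedInv
  rw [lintegral_pi_fin_succ P (H.measurable_inv_tiltMass μ (n + 1))]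
  refine lintegral_mono fun x => ?_
  rw [← lintegral_const_mul _ (H.measurable_inv_tiltMass _ n)]
  refine lintegral_mono fun s => ?_
  rw [← ENNReal.ofReal_mul (by positivity), ← ENNReal.ofReal_mul (by positivity)]
  refine ENNReal.ofReal_le_ofReal ?_
  simp only [Fin.sum_univ_succ, Fin.cons_zero, Fin.cons_succ]
  refine (inv_tiltMass_le_Icc H.continuous_logMGF hκμ _ _).trans ?_
  have hpos := tiltMass_Icc_pos (μ := μ) H.continuous_logMGF hκμ n (∑ i, Y (s i))
  refine (inv_anti₀ (by positivity) (tiltMass_Icc_succ (μ := μ) H.continuous_logMGF hL n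
    (∑ i, Y (s i)) (Y x))).trans_eq ?_
  rw [mul_inv, ← exp_neg, neg_neg, exp_add, mul_comm (exp L)]

theorem expectedInv_ne_top (H : IsTiltModel P Y μ D I) (n : ℕ) :
    expectedInv P Y (tiltMass μ D n) n ≠ ∞ := by
  obtain ⟨κ, ⟨hL, hκI⟩, hκ⟩ := ((H.eventually_logMGF_le one_pos).and
    H.eventually_Icc_subset).and self_mem_nhdsWithin |>.exists
  have hκ : 0 < κ := hκ
  have hY := H.measurable_stat
  have hp : κ ∈ Icc (-κ) κ := ⟨by linarith, le_rfl⟩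
  have hm : -κ ∈ Icc (-κ) κ := ⟨le_rfl, by linarith⟩
  have hq : 0 < μ.real (Icc (-κ) κ) :=
    ENNReal.toReal_pos (H.prior_pos κ hκ).ne' (measure_ne_top _ _)
  refine ne_top_of_le_ne_top (b := ∫⁻ s : Fin n → X,
    ENNReal.ofReal ((μ.real (Icc (-κ) κ))⁻¹ * exp n)
      * ENNReal.ofReal (exp (κ * |∑ i, Y (s i)|)) ∂(Measure.pi fun _ => P)) ?_ ?_
  · rw [lintegral_const_mul _ (by fun_prop)]
    exact ENNReal.mul_ne_top ENNReal.ofReal_ne_top (ne_top_of_le_ne_top ENNReal.ofReal_ne_top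
      (lintegral_exp_mul_abs_sum_le hY (H.mgf_eq κ (hκI hp)) (H.mgf_eq (-κ) (hκI hm))
        (hL κ hp) (hL (-κ) hm) n))
  · refine lintegral_mono fun s => ?_
    rw [← ENNReal.ofReal_mul (by positivity)]
    refine ENNReal.ofReal_le_ofReal ((inv_tiltMass_le_Icc H.continuous_logMGF
      (H.prior_pos κ hκ) n _).trans ?_)
    refine (inv_anti₀ (by positivity) (le_tiltMass_Icc (μ := μ) H.continuous_logMGF hL n
      _)).trans_eq ?_
    rw [mul_inv, ← exp_neg, neg_neg, mul_assoc, ← exp_add, mul_one, add_comm]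

/-- The expected inverse marginal likelihood ratio grows subexponentially, step by step. -/
theorem eventually_expectedInv_succ_le (H : IsTiltModel P Y μ D I) {a : ℝ} (ha : 1 < a) :
    ∀ᶠ n : ℕ in atTop, 0 < (expectedInv P Y (tiltMass μ D n) n).toReal ∧
      (expectedInv P Y (tiltMass μ D (n + 1)) (n + 1)).toReal
        ≤ a * (expectedInv P Y (tiltMass μ D n) n).toReal := by
  have hb : 1 < √a := by rwa [lt_sqrt zero_le_one, one_pow]
  obtain ⟨κ, hκ, hκI, L, hL, hone⟩ := H.exists_one_step_bound hb
  filter_upwards [H.eventually_expectedInv_Icc_le hκ hκI (sub_pos.2 hb),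
    H.eventually_le_expectedInv one_pos] with n hn hlow
  refine ⟨ENNReal.toReal_pos (ne_bot_of_le_ne_bot (by simp [exp_pos]) hlow)
    (H.expectedInv_ne_top n), ?_⟩
  have h1 : expectedInv P Y (tiltMass μ D (n + 1)) (n + 1)
      ≤ ENNReal.ofReal a * expectedInv P Y (tiltMass μ D n) n := by
    refine (H.expectedInv_succ_le hκ hL n).trans ((mul_le_mul' hone hn).trans_eq ?_)
    rw [← mul_assoc, ← ENNReal.ofReal_mul (by positivity)]
    congr 2
    rw [add_sub_cancel, mul_self_sqrt (by linarith)]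
  have h2 := ENNReal.toReal_mono
    (ENNReal.mul_ne_top ENNReal.ofReal_ne_top (H.expectedInv_ne_top n)) h1
  rwa [ENNReal.toReal_mul, ENNReal.toReal_ofReal (by linarith)] at h2

end IsTiltModel

end TiltModel

section ExponentialFamily

open Filter Topology

theorem tiltMass_map_withDensity {Θ : Set ℝ} (hΘ : MeasurableSet Θ) {h g : ℝ → ℝ}
    (hh : AEMeasurable h (volume.restrict Θ)) (hπ : AEMeasurable g (volume.restrict Θ))
    (hπ0 : ∀ θ ∈ Θ, 0 ≤ g θ) {D : ℝ → ℝ} (hD : Continuous D) (n : ℕ) (u : ℝ) :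
    tiltMass (((volume.restrict Θ).withDensity fun θ => ENNReal.ofReal (g θ)).map h) D n u
      = ∫ θ in Θ, exp (h θ * u - n * D (h θ)) * g θ := by
  unfold tiltMass
  rw [integral_map (hh.mono_ac (withDensity_absolutelyContinuous _ _))
      (Continuous.aestronglyMeasurable (by fun_prop)),
    integral_withDensity_eq_integral_toReal_smul₀ hπ.ennreal_ofReal (by simp)]
  refine setIntegral_congr_fun hΘ fun θ hθ => ?_
  simp only [smul_eq_mul, ENNReal.toReal_ofReal (hπ0 θ hθ), mul_comm]

theorem toReal_expectedInv_withDensity {X : Type*} [MeasurableSpace X] (ν : Measure X)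
    [SigmaFinite ν] {f : X → ℝ}
    (hf : Measurable f) (hf0 : ∀ x, 0 ≤ f x)
    [SigmaFinite (ν.withDensity fun x => ENNReal.ofReal (f x))] {Y : X → ℝ} (hY : Measurable Y)
    {M : ℝ → ℝ} (hM : Measurable M) (hM0 : ∀ u, 0 ≤ M u) (n : ℕ) :
    (expectedInv (ν.withDensity fun x => ENNReal.ofReal (f x)) Y M n).toReal
      = ∫ s : Fin n → X, (∏ i, f (s i)) * (M (∑ i, Y (s i)))⁻¹ ∂(Measure.pi fun _ => ν) := by
  have hMs : Measurable fun s : Fin n → X => M (∑ i, Y (s i)) := hM.comp (by fun_prop)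
  have hMi : Measurable fun s : Fin n → X => ENNReal.ofReal (M (∑ i, Y (s i)))⁻¹ :=
    hMs.inv.ennreal_ofReal
  have hprod : Measurable fun s : Fin n → X => ∏ i, f (s i) := by fun_prop
  rw [integral_eq_lintegral_of_nonneg_ae
      (Eventually.of_forall fun s => mul_nonneg (Finset.prod_nonneg fun i _ => hf0 _)
        (inv_nonneg.2 (hM0 _))) (hprod.mul hMs.inv).aestronglyMeasurable,
    expectedInv, pi_withDensity ν hf.ennreal_ofReal,
    lintegral_withDensity_eq_lintegral_mul _ (by fun_prop) hMi]
  congr 1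
  refine lintegral_congr fun s => ?_
  simp only [Pi.mul_apply]
  rw [ENNReal.ofReal_mul (Finset.prod_nonneg fun i _ => hf0 _),
    ENNReal.ofReal_prod_of_nonneg fun _ _ => hf0 _]

theorem strictMonoOn_of_hasDerivWithinAt_pos {Θ : Set ℝ} (hΘ : Convex ℝ Θ) {η ηd : ℝ → ℝ}
    (hη : ∀ θ ∈ Θ, HasDerivWithinAt η (ηd θ) Θ θ) (hηd : ∀ θ ∈ Θ, 0 < ηd θ) :
    StrictMonoOn η Θ :=
  strictMonoOn_of_deriv_pos hΘ (fun θ hθ => (hη θ hθ).continuousWithinAt) fun θ hθ => by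
    rw [((hη θ (interior_subset hθ)).hasDerivAt (mem_interior_iff_mem_nhds.1 hθ)).deriv]
    exact hηd θ (interior_subset hθ)

theorem image_mem_nhds_of_strictMonoOn {Θ : Set ℝ} {η : ℝ → ℝ} (hc : ContinuousOn η Θ)
    (hmono : StrictMonoOn η Θ) {θ : ℝ} (hθ : θ ∈ interior Θ) : η '' Θ ∈ 𝓝 (η θ) := by
  obtain ⟨r, hr, hrΘ⟩ := Metric.nhds_basis_closedBall.mem_iff.1 (mem_interior_iff_mem_nhds.1 hθ)
  rw [Real.closedBall_eq_Icc] at hrΘ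
  have ha : θ - r ∈ Θ := hrΘ ⟨le_rfl, by linarith⟩
  have hb : θ + r ∈ Θ := hrΘ ⟨by linarith, le_rfl⟩
  have hθ' := interior_subset hθ
  refine mem_of_superset (Icc_mem_nhds (hmono ha hθ' (by linarith))
    (hmono hθ' hb (by linarith))) ?_
  exact (intermediate_value_Icc (by linarith) (hc.mono hrΘ)).trans (image_mono hrΘ)

/-- The Bregman remainder of `A` at `e`. -/
noncomputable def bregman (A : ℝ → ℝ) (e t : ℝ) : ℝ := A (e + t) - A e - deriv A e * t

theorem continuous_bregman {A : ℝ → ℝ} (hA : Continuous A) (e : ℝ) : Continuous (bregman A e) := by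
  unfold bregman
  fun_prop

theorem hasDerivAt_bregman {A : ℝ → ℝ} {e : ℝ} (hA : DifferentiableAt ℝ A e) :
    HasDerivAt (bregman A e) 0 0 := by
  have h1 : HasDerivAt A (deriv A e) (e + 0) := by rw [add_zero]; exact hA.hasDerivAt
  have h2 := ((h1.comp_const_add e 0).sub_const (A e)).sub
    ((hasDerivAt_id (0 : ℝ)).const_mul (deriv A e))
  rw [mul_one, sub_self] at h2
  exact h2

theorem strictConvexOn_bregman {A : ℝ → ℝ} {J : Set ℝ} (hA : StrictConvexOn ℝ J A) (e : ℝ) :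
    StrictConvexOn ℝ ((fun t => e + t) ⁻¹' J) (bregman A e) := by
  have h := hA.translate_right e
  refine ⟨h.1, fun x hx y hy hxy a b ha hb hab => ?_⟩
  have h1 := h.2 hx hy hxy ha hb hab
  simp only [Function.comp_apply, smul_eq_mul] at h1
  simp only [bregman, smul_eq_mul]
  have h2 : A e = a * A e + b * A e := by rw [← add_mul, hab, one_mul]
  linarith

theorem bregman_sub {A : ℝ → ℝ} (e e' : ℝ) :
    bregman A e (e' - e) = A e' - A e - deriv A e * (e' - e) := by
  rw [bregman, add_sub_cancel]

section Density

variable {X : Type*} {η : ℝ → ℝ} {T B : X → ℝ} {A : ℝ → ℝ} {p : ℝ → X → ℝ}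

theorem density_eq_mul_exp (hp : ∀ θ x, p θ x = exp (η θ * T x - A (η θ) - B x))
    (θ θ₂ : ℝ) (x : X) :
    p θ x = p θ₂ x * exp ((η θ - η θ₂) * (T x - deriv A (η θ₂))
      - bregman A (η θ₂) (η θ - η θ₂)) := by
  rw [hp, hp, ← exp_add, bregman_sub]
  congr 1
  ring

theorem prod_density_eq (hp : ∀ θ x, p θ x = exp (η θ * T x - A (η θ) - B x))
    (θ θ₂ : ℝ) {n : ℕ} (s : Fin n → X) :
    ∏ i, p θ (s i) = (∏ i, p θ₂ (s i)) * exp ((η θ - η θ₂) * ∑ i, (T (s i) - deriv A (η θ₂))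
      - n * bregman A (η θ₂) (η θ - η θ₂)) := by
  rw [Finset.prod_congr rfl fun i _ => density_eq_mul_exp hp θ θ₂ (s i), Finset.prod_mul_distrib,
    ← exp_sum, Finset.sum_sub_distrib, ← Finset.mul_sum]
  simp

theorem density_mul_density (hp : ∀ θ x, p θ x = exp (η θ * T x - A (η θ) - B x))
    {θ₀ θ₁ θ₂ : ℝ} (hθ₂ : η θ₂ = (η θ₀ + η θ₁) / 2) (x : X) :
    p θ₀ x * p θ₁ x = exp (2 * A (η θ₂) - A (η θ₀) - A (η θ₁)) * (p θ₂ x * p θ₂ x) := by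
  simp only [hp, ← exp_add]
  congr 1
  rw [show η θ₀ = 2 * η θ₂ - η θ₁ by linarith]
  ring

end Density

section Family

variable {X : Type*} [MeasurableSpace X] {ν : Measure X} {Θ : Set ℝ} {η : ℝ → ℝ} {T B : X → ℝ}
  {A : ℝ → ℝ} {p : ℝ → X → ℝ}

theorem measurable_density (hT : Measurable T) (hB : Measurable B)
    (hp : ∀ θ x, p θ x = exp (η θ * T x - A (η θ) - B x)) (θ : ℝ) : Measurable (p θ) := by
  rw [show p θ = _ from funext (hp θ)]
  fun_prop

theorem lintegral_density (hp : ∀ θ x, p θ x = exp (η θ * T x - A (η θ) - B x)) {θ : ℝ}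
    (h : ∫ x, p θ x ∂ν = 1) : ∫⁻ x, ENNReal.ofReal (p θ x) ∂ν = 1 := by
  have hi : Integrable (p θ) ν := by
    by_contra hn
    simp [integral_undef hn] at h
  rw [← ofReal_integral_eq_lintegral_ofReal hi
    (Eventually.of_forall fun x => by simp [hp, exp_nonneg]), h, ENNReal.ofReal_one]

theorem mgf_withDensity (hT : Measurable T) (hB : Measurable B)
    (hp : ∀ θ x, p θ x = exp (η θ * T x - A (η θ) - B x)) {θ θ₂ : ℝ}
    (h : ∫ x, p θ x ∂ν = 1) :
    ∫⁻ x, ENNReal.ofReal (exp ((η θ - η θ₂) * (T x - deriv A (η θ₂))))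
        ∂(ν.withDensity fun x => ENNReal.ofReal (p θ₂ x))
      = ENNReal.ofReal (exp (bregman A (η θ₂) (η θ - η θ₂))) := by
  rw [lintegral_withDensity_eq_lintegral_mul _ (measurable_density hT hB hp θ₂).ennreal_ofReal
    (by fun_prop), ← mul_one (ENNReal.ofReal (exp (bregman _ _ _))), ← lintegral_density hp h,
    ← lintegral_const_mul _ (measurable_density hT hB hp θ).ennreal_ofReal]
  refine lintegral_congr fun x => ?_
  rw [Pi.mul_apply, ← ENNReal.ofReal_mul (by simp [hp, exp_nonneg]),
    ← ENNReal.ofReal_mul (exp_nonneg _)]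
  congr 1
  rw [density_eq_mul_exp hp θ θ₂, mul_left_comm, ← exp_add, add_sub_cancel]

theorem isTiltModel_exponentialFamily (hΘconv : Convex ℝ Θ) (hc : ContinuousOn η Θ)
    (hmono : StrictMonoOn η Θ) (hT : Measurable T) (hB : Measurable B)
    (hA : Differentiable ℝ A) (hAconv : StrictConvexOn ℝ (η '' Θ) A)
    (hp : ∀ θ x, p θ x = exp (η θ * T x - A (η θ) - B x)) (hpint : ∀ θ ∈ Θ, ∫ x, p θ x ∂ν = 1)
    {g : ℝ → ℝ} (hπ : AEMeasurable g (volume.restrict Θ)) (hπpos : ∀ θ ∈ Θ, 0 < g θ)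
    {θ₂ : ℝ} (hθ₂ : θ₂ ∈ interior Θ) :
    IsTiltModel (ν.withDensity fun x => ENNReal.ofReal (p θ₂ x))
      (fun x => T x - deriv A (η θ₂))
      (((volume.restrict Θ).withDensity fun θ => ENNReal.ofReal (g θ)).map
        fun θ => η θ - η θ₂)
      (bregman A (η θ₂)) ((fun t => η θ₂ + t) ⁻¹' (η '' Θ)) := by
  have hΘm : MeasurableSet Θ := hΘconv.ordConnected.measurableSet
  have hh : AEMeasurable (fun θ => η θ - η θ₂)
      ((volume.restrict Θ).withDensity fun θ => ENNReal.ofReal (g θ)) :=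
    ((hc.aemeasurable hΘm).sub_const _).mono_ac (withDensity_absolutelyContinuous _ _)
  have hD := strictConvexOn_bregman hAconv (η θ₂)
  refine ⟨by fun_prop, continuous_bregman hA.continuous _, by simp [bregman],
    hasDerivAt_bregman hA.differentiableAt, hD, ?_, ?_, ?_, fun κ hκ => ?_⟩
  · have : ContinuousAt (fun t => η θ₂ + t) 0 := by fun_prop
    exact this (by beta_reduce; rw [add_zero]; exact image_mem_nhds_of_strictMonoOn hc hmono hθ₂)
  · rintro t ⟨θ, hθ, ht⟩
    obtain rfl : t = η θ - η θ₂ := by simp only at ht; linarith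
    exact mgf_withDensity hT hB hp (hpint θ hθ)
  · refine (ae_map_iff hh hD.1.ordConnected.measurableSet).2 ?_
    refine (withDensity_absolutelyContinuous _ _).ae_le ?_
    filter_upwards [ae_restrict_mem hΘm] with θ hθ
    exact ⟨θ, hθ, by ring⟩
  · have hcθ : ContinuousAt (fun θ => η θ - η θ₂) θ₂ :=
      (hc.continuousAt (mem_interior_iff_mem_nhds.1 hθ₂)).sub continuousAt_const
    have hnhds : (fun θ => η θ - η θ₂) ⁻¹' Icc (-κ) κ ∈ 𝓝 θ₂ :=
      hcθ (by beta_reduce; rw [sub_self]; exact Icc_mem_nhds (by linarith) hκ)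
    rw [Measure.map_apply_of_aemeasurable hh measurableSet_Icc]
    have hac : volume.restrict Θ ≪
        (volume.restrict Θ).withDensity fun θ => ENNReal.ofReal (g θ) :=
      withDensity_absolutelyContinuous' hπ.ennreal_ofReal (by
        filter_upwards [ae_restrict_mem hΘm] with θ hθ
        simpa using hπpos θ hθ)
    refine pos_iff_ne_zero.2 fun h0 => ?_
    have h1 := hac h0
    rw [Measure.restrict_apply' hΘm] at h1
    exact (Measure.measure_pos_of_mem_nhds volume
      (inter_mem hnhds (mem_interior_iff_mem_nhds.1 hθ₂))).ne' h1

theorem expectedPosterior_eq [SigmaFinite ν] (hΘconv : Convex ℝ Θ) (hc : ContinuousOn η Θ)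
    (hT : Measurable T) (hB : Measurable B) (hA : Continuous A)
    (hp : ∀ θ x, p θ x = exp (η θ * T x - A (η θ) - B x))
    {g : ℝ → ℝ} (hπ : AEMeasurable g (volume.restrict Θ)) (hπpos : ∀ θ ∈ Θ, 0 < g θ)
    {θ₀ θ₁ θ₂ : ℝ} (hθ₂ : η θ₂ = (η θ₀ + η θ₁) / 2)
    [SigmaFinite (ν.withDensity fun x => ENNReal.ofReal (p θ₂ x))]
    [IsFiniteMeasure (((volume.restrict Θ).withDensity fun θ => ENNReal.ofReal (g θ)).map
        fun θ => η θ - η θ₂)] (n : ℕ) :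
    expectedPosterior ν Θ g p θ₀ θ₁ n
      = g θ₀ * exp (2 * A (η θ₂) - A (η θ₀) - A (η θ₁)) ^ n *
        (expectedInv (ν.withDensity fun x => ENNReal.ofReal (p θ₂ x))
          (fun x => T x - deriv A (η θ₂))
          (tiltMass (((volume.restrict Θ).withDensity fun θ => ENNReal.ofReal (g θ)).map
            fun θ => η θ - η θ₂) (bregman A (η θ₂)) n) n).toReal := by
  have hΘm : MeasurableSet Θ := hΘconv.ordConnected.measurableSet
  have hD := continuous_bregman hA (η θ₂)
  have hpos (θ : ℝ) (x : X) : 0 < p θ x := by rw [hp]; exact exp_pos _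
  rw [toReal_expectedInv_withDensity ν (measurable_density hT hB hp θ₂)
    (fun x => (hpos θ₂ x).le) (by fun_prop) (measurable_tiltMass hD n)
    (fun u => integral_nonneg fun _ => (exp_pos _).le), expectedPosterior, ← integral_const_mul]
  congr 1
  funext s
  rw [tiltMass_map_withDensity hΘm ((hc.aemeasurable hΘm).sub_const _) hπ
    (fun θ hθ => (hπpos θ hθ).le) hD]
  have h1 : ∫ θ in Θ, (∏ i, p θ (s i)) * g θ = (∏ i, p θ₂ (s i)) *
      ∫ θ in Θ, exp ((η θ - η θ₂) * ∑ i, (T (s i) - deriv A (η θ₂))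
        - n * bregman A (η θ₂) (η θ - η θ₂)) * g θ := by
    rw [← integral_const_mul]
    congr 1
    funext θ
    rw [prod_density_eq hp θ θ₂, mul_assoc]
  have h2 : (∏ i, p θ₀ (s i)) * ∏ i, p θ₁ (s i)
      = exp (2 * A (η θ₂) - A (η θ₀) - A (η θ₁)) ^ n
        * ((∏ i, p θ₂ (s i)) * ∏ i, p θ₂ (s i)) := by
    simp only [← Finset.prod_mul_distrib, density_mul_density hp hθ₂]
    simp [Finset.prod_mul_distrib]
  have hw : (∏ i, p θ₂ (s i)) ≠ 0 := (Finset.prod_pos fun i _ => hpos θ₂ (s i)).ne'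
  rw [h1, div_mul_eq_mul_div, mul_right_comm, h2]
  generalize ∫ θ in Θ, exp ((η θ - η θ₂) * ∑ i, (T (s i) - deriv A (η θ₂))
    - n * bregman A (η θ₂) (η θ - η θ₂)) * g θ = I
  field_simp

end Family

end ExponentialFamily

end ExpectedPosterior

/-- One-dimensional exponential family setup.  For `θ₀ ≠ θ₁` in `Θ` such
that the point `θ₂ ∈ Θ` with `η θ₂ = (η θ₀ + η θ₁)/2` is interior, the sequence
`ψ_{θ₀,θ₁}(n) = E_{θ₁}[q_n^{θ₀}]` is eventually strictly decreasing. -/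
theorem expected_posterior_eventually_decreasing
    {X : Type*} [MeasurableSpace X] (ν : Measure X) [SigmaFinite ν]
    (Θ : Set ℝ) (hΘconv : Convex ℝ Θ) (hΘnontriv : ∃ a ∈ Θ, ∃ b ∈ Θ, a ≠ b)
    (η ηd : ℝ → ℝ)
    (hη : ∀ θ ∈ Θ, HasDerivWithinAt η (ηd θ) Θ θ)
    (hηd : ∀ θ ∈ Θ, 0 < ηd θ)
    (T B : X → ℝ) (hT : Measurable T) (hB : Measurable B)
    (A : ℝ → ℝ) (hA : ContDiff ℝ 2 A)
    (hA'' : ∀ θ ∈ Θ, 0 < iteratedDeriv 2 A (η θ))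
    (p : ℝ → X → ℝ)
    (hp : ∀ θ x, p θ x = Real.exp (η θ * T x - A (η θ) - B x))
    (hpint : ∀ θ ∈ Θ, ∫ x, p θ x ∂ν = 1)
    (π : ℝ → ℝ) (hπc : ContinuousOn π Θ) (hπpos : ∀ θ ∈ Θ, 0 < π θ)
    (hπint : ∫ θ in Θ, π θ = 1)
    (θ₀ θ₁ : ℝ) (hθ₀ : θ₀ ∈ Θ) (hθ₁ : θ₁ ∈ Θ) (hne : θ₀ ≠ θ₁)
    (θ₂ : ℝ) (hθ₂mem : θ₂ ∈ Θ) (hθ₂ : η θ₂ = (η θ₀ + η θ₁) / 2)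
    (hθ₂int : θ₂ ∈ interior Θ) :
    ∃ N : ℕ, ∀ n : ℕ, N ≤ n →
      expectedPosterior ν Θ π p θ₀ θ₁ (n + 1) < expectedPosterior ν Θ π p θ₀ θ₁ n := by
  have hc : ContinuousOn η Θ := fun θ hθ => (hη θ hθ).continuousWithinAt
  have hmono := ExpectedPosterior.strictMonoOn_of_hasDerivWithinAt_pos hΘconv hη hηd
  have hΘm : MeasurableSet Θ := hΘconv.ordConnected.measurableSet
  have hAconv : StrictConvexOn ℝ (η '' Θ) A := by
    refine strictConvexOn_of_deriv2_pos' ?_ hA.continuous.continuousOn ?_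
    · exact (hΘconv.isPreconnected.image η hc).ordConnected.convex
    · rintro _ ⟨θ, hθ, rfl⟩
      rw [← iteratedDeriv_eq_iterate]
      exact hA'' θ hθ
  have hπm : AEMeasurable π (volume.restrict Θ) := hπc.aemeasurable hΘm
  have hP : IsProbabilityMeasure (ν.withDensity fun x => ENNReal.ofReal (p θ₂ x)) :=
    ⟨by rw [withDensity_apply _ MeasurableSet.univ, Measure.restrict_univ,
      ExpectedPosterior.lintegral_density hp (hpint θ₂ hθ₂mem)]⟩
  have hπprob :
      IsProbabilityMeasure ((volume.restrict Θ).withDensity fun θ => ENNReal.ofReal (π θ)) := by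
    refine ⟨?_⟩
    rw [withDensity_apply _ MeasurableSet.univ, Measure.restrict_univ]
    have hi : IntegrableOn π Θ := by
      by_contra hn
      simp [integral_undef hn] at hπint
    rw [← ofReal_integral_eq_lintegral_ofReal hi, hπint, ENNReal.ofReal_one]
    filter_upwards [ae_restrict_mem hΘm] with θ hθ using (hπpos θ hθ).le
  have hμ : IsProbabilityMeasure
      (((volume.restrict Θ).withDensity fun θ => ENNReal.ofReal (π θ)).map
        fun θ => η θ - η θ₂) :=
    Measure.isProbabilityMeasure_map (((hc.aemeasurable hΘm).sub_const _).mono_ac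
      (withDensity_absolutelyContinuous _ _))
  have H := ExpectedPosterior.isTiltModel_exponentialFamily hΘconv hc hmono hT hB
    (hA.differentiable two_ne_zero) hAconv hp hpint hπm hπpos hθ₂int
  set ρ := Real.exp (2 * A (η θ₂) - A (η θ₀) - A (η θ₁)) with hρ
  have hρ0 : 0 < ρ := Real.exp_pos _
  have hρ1 : ρ < 1 := by
    have hlt := hAconv.2 ⟨θ₀, hθ₀, rfl⟩ ⟨θ₁, hθ₁, rfl⟩ (hmono.injOn.ne hθ₀ hθ₁ hne)
      (by norm_num : (0 : ℝ) < 1 / 2) (by norm_num : (0 : ℝ) < 1 / 2) (by norm_num)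
    simp only [smul_eq_mul] at hlt
    rw [show 1 / 2 * η θ₀ + 1 / 2 * η θ₁ = η θ₂ by rw [hθ₂]; ring] at hlt
    rw [hρ, Real.exp_lt_one_iff]
    linarith
  obtain ⟨a, ha1, haρ⟩ := exists_between ((one_lt_inv₀ hρ0).2 hρ1)
  obtain ⟨N, hN⟩ := Filter.eventually_atTop.1 (H.eventually_expectedInv_succ_le ha1)
  refine ⟨N, fun n hn => ?_⟩
  obtain ⟨hpos, hle⟩ := hN n hn
  simp only [ExpectedPosterior.expectedPosterior_eq hΘconv hc hT hB hA.continuous hp hπm hπpos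
    hθ₂, ← hρ]
  have hc0 : 0 < π θ₀ * ρ ^ n := mul_pos (hπpos θ₀ hθ₀) (pow_pos hρ0 n)
  rw [pow_succ, ← mul_assoc (π θ₀), mul_assoc (π θ₀ * ρ ^ n)]
  refine mul_lt_mul_of_pos_left ?_ hc0
  refine (mul_le_mul_of_nonneg_left hle hρ0.le).trans_lt ?_
  rw [← mul_assoc]
  refine mul_lt_of_lt_one_left hpos ?_
  rwa [mul_comm, ← lt_inv_mul_iff₀' hρ0, mul_one]
end

section
/- Let θ₀, θ₁ ∈ (0,1) and for each integer n ≥ 1 define ψ(n) := ∑_{k=0}^{n} C(n,k) θ₁^k (1−θ₁)^{n−k} · [θ₀^k (1−θ₀)^{n−k} / ∫₀¹ t^k (1−t)^{n−k} dt] (this is the expected θ₀-posterior after n iid Bernoulli(θ) observations generated under θ₁, when θ has the uniform prior on (0,1); equivalently ψ(n) = (n+1) ∑_{k=0}^{n} C(n,k)² (θ₀θ₁)^k ((1−θ₀)(1−θ₁))^{n−k}). Then the sequence ψ(n) is log-concave for n ≥ 1 and strictly log-concave for n ≥ 2; that is, ψ(n)² ≥ ψ(n−1)·ψ(n+1) for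 every n ≥ 2, with strict inequality for every n ≥ 3. In particular ψ(n) is unimodal in n. -/
open Polynomial in
/-- The polynomials `∑ C(n,k)² Xᵏ`, a form of the Legendre polynomials. -/
noncomputable def chooseSqPoly (n : ℕ) : ℝ[X] :=
  ∑ k ∈ Finset.range (n + 1), C ((n.choose k : ℝ) ^ 2) * X ^ k

lemma chooseSqPoly_coeff (n k : ℕ) : (chooseSqPoly n).coeff k = (n.choose k : ℝ) ^ 2 := by
  simp only [chooseSqPoly, Polynomial.finsetSum_coeff, Polynomial.coeff_C_mul_X_pow,
    Finset.sum_ite_eq, Finset.mem_range]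
  split_ifs with h
  · rfl
  · rw [Nat.choose_eq_zero_of_lt (by omega)]
    simp

lemma cast_choose_succ_mul (n k : ℕ) :
    (n.choose (k + 1) : ℝ) * (k + 1) = n.choose k * (n - k) := by
  rcases le_or_gt k n with h | h
  · have := Nat.choose_succ_right_eq n k
    rw [← Nat.cast_sub h]
    exact_mod_cast this
  · simp [Nat.choose_eq_zero_of_lt h, Nat.choose_eq_zero_of_lt (Nat.lt_succ_of_lt h)]

open Polynomial in
/-- The three-term (Bonnet) recurrence. -/
lemma chooseSqPoly_recurrence (n : ℕ) :
    C ((n : ℝ) + 2) * chooseSqPoly (n + 2) =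
      C (2 * (n : ℝ) + 3) * (chooseSqPoly (n + 1) + chooseSqPoly (n + 1) * X) -
        C ((n : ℝ) + 1) *
          (chooseSqPoly n - C 2 * (chooseSqPoly n * X) + chooseSqPoly n * X * X) := by
  ext k
  simp only [coeff_C_mul, coeff_sub, coeff_add, chooseSqPoly_coeff]
  rcases k with _ | _ | k
  · simp
    ring
  · simp only [coeff_mul_X, coeff_mul_X_zero, chooseSqPoly_coeff, zero_add, Nat.choose_one_right,
      Nat.choose_zero_right]
    push_cast
    ring
  · simp only [coeff_mul_X, chooseSqPoly_coeff]
    have h1 := cast_choose_succ_mul n k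
    have h2 := cast_choose_succ_mul n (k + 1)
    simp only [Nat.choose_succ_succ' (n + 1) (k + 1), Nat.choose_succ_succ' n (k + 1),
      Nat.choose_succ_succ' n k]
    push_cast at *
    generalize (n.choose k : ℝ) = p at *
    generalize (n.choose (k + 1) : ℝ) = q at *
    generalize (n.choose (k + 1 + 1) : ℝ) = u at *
    linear_combination 2 * (-u - q) * h1 + 2 * (p + q) * h2

/-- `∑ C(n,k)² aᵏ bⁿ⁻ᵏ`. -/
noncomputable def chooseSqSum (a b : ℝ) (n : ℕ) : ℝ :=
  ∑ k ∈ Finset.range (n + 1), (n.choose k : ℝ) ^ 2 * a ^ k * b ^ (n - k)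

lemma chooseSqSum_eq_eval {a b : ℝ} (hb : b ≠ 0) (n : ℕ) :
    chooseSqSum a b n = b ^ n * (chooseSqPoly n).eval (a / b) := by
  rw [chooseSqSum, chooseSqPoly, Polynomial.eval_finsetSum, Finset.mul_sum]
  refine Finset.sum_congr rfl fun k hk => ?_
  have h : b ^ n = b ^ (n - k) * b ^ k := by
    rw [← pow_add, Nat.sub_add_cancel (by simpa [Nat.lt_succ_iff] using hk)]
  simp only [Polynomial.eval_mul, Polynomial.eval_C, Polynomial.eval_pow, Polynomial.eval_X,
    div_pow, h]
  field_simp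

lemma chooseSqSum_recurrence {a b : ℝ} (hb : b ≠ 0) (n : ℕ) :
    (n + 2) * chooseSqSum a b (n + 2) =
      (2 * n + 3) * (a + b) * chooseSqSum a b (n + 1) -
        (n + 1) * (b - a) ^ 2 * chooseSqSum a b n := by
  have h := congrArg (Polynomial.eval (a / b)) (chooseSqPoly_recurrence n)
  simp only [Polynomial.eval_mul, Polynomial.eval_C, Polynomial.eval_X, Polynomial.eval_sub,
    Polynomial.eval_add] at h
  have hx : a = b * (a / b) := by field_simp
  simp only [chooseSqSum_eq_eval hb]
  generalize a / b = x at *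
  subst hx
  linear_combination b ^ (n + 2) * h

lemma chooseSqSum_pos {a b : ℝ} (ha : 0 < a) (hb : 0 < b) (n : ℕ) : 0 < chooseSqSum a b n := by
  refine Finset.sum_pos (fun k hk => ?_) ⟨0, by simp⟩
  have : 0 < n.choose k := Nat.choose_pos (by simpa [Nat.lt_succ_iff] using hk)
  positivity

lemma integral_pow_mul_one_sub_pow_succ (k j : ℕ) :
    (k + 1) * ∫ t in (0:ℝ)..1, t ^ k * (1 - t) ^ (j + 1) =
      (j + 1) * ∫ t in (0:ℝ)..1, t ^ (k + 1) * (1 - t) ^ j := by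
  have h : ∫ t in (0:ℝ)..1, ((k + 1) * (t ^ k * (1 - t) ^ (j + 1)) -
      (j + 1) * (t ^ (k + 1) * (1 - t) ^ j)) = 0 := by
    rw [intervalIntegral.integral_eq_sub_of_hasDerivAt
      (f := fun t : ℝ => t ^ (k + 1) * (1 - t) ^ (j + 1))]
    · simp
    · intro t _
      have h1 := hasDerivAt_pow (k + 1) t
      have h2 := ((hasDerivAt_id t).const_sub 1).pow (j + 1)
      refine (h1.mul h2).congr_deriv ?_
      simp
      ring
    · exact Continuous.intervalIntegrable (by fun_prop) _ _
  rw [intervalIntegral.integral_sub (Continuous.intervalIntegrable (by fun_prop) _ _)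
    (Continuous.intervalIntegrable (by fun_prop) _ _), intervalIntegral.integral_const_mul,
    intervalIntegral.integral_const_mul] at h
  linarith

lemma integral_pow_mul_one_sub_pow (j k : ℕ) :
    (k + j + 1) * ((k + j).choose k : ℝ) * ∫ t in (0:ℝ)..1, t ^ k * (1 - t) ^ j = 1 := by
  induction j generalizing k with
  | zero =>
    simp
    field_simp
  | succ j ih =>
    have h := integral_pow_mul_one_sub_pow_succ k j
    have ih' := ih (k + 1)
    have hc := cast_choose_succ_mul (k + (j + 1)) k
    rw [show k + 1 + j = k + (j + 1) by ring] at ih'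
    push_cast at *
    have hj : (j : ℝ) + 1 ≠ 0 := by positivity
    generalize (∫ t in (0:ℝ)..1, t ^ k * (1 - t) ^ (j + 1)) = I at *
    generalize (∫ t in (0:ℝ)..1, t ^ (k + 1) * (1 - t) ^ j) = J at *
    generalize ((k + (j + 1)).choose k : ℝ) = p at *
    generalize ((k + (j + 1)).choose (k + 1) : ℝ) = q at *
    have hk : (k : ℝ) + 1 ≠ 0 := by positivity
    apply mul_left_cancel₀ hk
    linear_combination (k + j + 2) * p * h - (k + j + 2) * J * hc + (k + 1) * ih'

/-- Lower bound for a solution of the Riccati recurrence satisfied by the ratios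
`z n = f (n+1) / (s * f n) - 1`. -/
lemma riccati_lower_bound {ε : ℝ} (hε : 0 ≤ ε) (hε1 : ε ≤ 1) {z : ℕ → ℝ} (hz : ∀ n, 0 ≤ z n)
    (hrec : ∀ n : ℕ, (n + 2) * z (n + 1) * (1 + z n) = (n + 1) * (z n + ε)) (n : ℕ) :
    4 * n * ε ≤ z n * (8 + (n - 1) * (n + 2) * ε) := by
  induction n with
  | zero =>
    push_cast
    have := hz 0
    nlinarith
  | succ n ih =>
    have hr := hrec n
    have hw := hz n
    push_cast
    generalize z (n + 1) = w at *
    generalize z n = x at *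
    have hn : (0 : ℝ) ≤ n := n.cast_nonneg
    have hn2 : 0 ≤ (n : ℝ) * (n - 1) := by
      rcases n with _ | n
      · simp
      · push_cast
        have : (0 : ℝ) ≤ n := n.cast_nonneg
        nlinarith
    generalize (n : ℝ) = m at *
    have hD : 0 < 8 + (m - 1) * (m + 2) * ε := by nlinarith
    have hc : 0 ≤ 8 + (m ^ 2 - m - 8) * ε := by nlinarith
    have key : 0 ≤ x * (8 + (m ^ 2 - m - 8) * ε) + m * (m + 3) * ε ^ 2 - 4 * m * ε := by
      refine nonneg_of_mul_nonneg_left (b := 8 + (m - 1) * (m + 2) * ε) ?_ hD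
      have h1 := mul_le_mul_of_nonneg_right ih hc
      have h2 : 0 ≤ (m * (m - 1)) * ((m + 2) * (m + 3) * ε ^ 3) := by positivity
      linarith
    have hpos : 0 < (m + 2) * (1 + x) := by positivity
    refine le_of_mul_le_mul_left (a := (m + 2) * (1 + x)) ?_ hpos
    have h3 := mul_nonneg (by positivity : (0:ℝ) ≤ m + 1) key
    linear_combination h3 - (8 + m * (m + 3) * ε) * hr

/-- The quadratic inequality for `z = f m / (s * f (m-1)) - 1` when `z` is small. -/
lemma quadratic_bound_of_small {m ε z : ℝ} (hm : 3 ≤ m) (hz : 0 ≤ z)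
    (hzm : (m + 1) * z ≤ 1) (hlow : 4 * (m - 1) * ε ≤ z * (8 + (m - 2) * (m + 1) * ε)) :
    m ^ 2 * (m + 2) * ε < (m + 1) + (m ^ 2 + 4 * m + 2) * z + (m + 1) ^ 3 * z ^ 2 := by
  obtain ⟨k, rfl⟩ : ∃ k, m = k + 3 := ⟨m - 3, by ring⟩
  have hk : 0 ≤ k := by linarith
  generalize hv : (k + 3 + 1) * z = v at *
  have hz' : z = v / (k + 4) := by
    rw [eq_div_iff (by positivity)]
    linarith
  have hv0 : 0 ≤ v := by rw [← hv]; positivity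
  have hT : 0 < 4 * (k + 2) - (k + 1) * v := by nlinarith
  have hquad : 0 < (4 * (k + 2) * (k + 4) ^ 2)
      - (5 * (k + 3) ^ 3 + 4 * (k + 3) ^ 2 + 5 * (k + 3) + 6) * v
      + (2 * (k + 3) ^ 3 + 2 * (k + 3) ^ 2 + 5 * (k + 3) + 2) * v ^ 2 := by
    set c := 4 * (k + 2) * (k + 4) ^ 2 with hc
    set d := 5 * (k + 3) ^ 3 + 4 * (k + 3) ^ 2 + 5 * (k + 3) + 6 with hd
    set e := 2 * (k + 3) ^ 3 + 2 * (k + 3) ^ 2 + 5 * (k + 3) + 2 with he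
    have hcp : 0 < c := by positivity
    have hdisc : 0 < 4 * c * e - d ^ 2 := by
      rw [hc, hd, he]
      ring_nf
      positivity
    rcases hv0.eq_or_lt with rfl | hvp
    · simpa using hcp
    · have h1 : 0 < (4 * c * e - d ^ 2) * v ^ 2 := by positivity
      refine pos_of_mul_pos_right (a := 4 * c) ?_ (by positivity)
      nlinarith [sq_nonneg (2 * c - d * v)]
  have hcube : 0 ≤ (k + 1) * (k + 4) ^ 2 * (v ^ 2 * (1 - v)) := by
    have : 0 ≤ 1 - v := by linarith
    positivity
  have hG : 8 * v * (k + 3) ^ 2 * (k + 5) < (4 * (k + 2) - (k + 1) * v) *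
      ((k + 4) ^ 2 + ((k + 3) ^ 2 + 4 * (k + 3) + 2) * v + (k + 4) ^ 2 * v ^ 2) := by
    linarith
  have hε : ε * (4 * (k + 2) - (k + 1) * v) ≤ 8 * z := by
    rw [← hv]
    linarith
  refine lt_of_mul_lt_mul_left (a := (k + 4) * (4 * (k + 2) - (k + 1) * v)) ?_ (by positivity)
  calc (k + 4) * (4 * (k + 2) - (k + 1) * v) * ((k + 3) ^ 2 * (k + 3 + 2) * ε)
      = (k + 4) * (k + 3) ^ 2 * (k + 5) * (ε * (4 * (k + 2) - (k + 1) * v)) := by ring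
    _ ≤ (k + 4) * (k + 3) ^ 2 * (k + 5) * (8 * z) := by gcongr
    _ = 8 * v * (k + 3) ^ 2 * (k + 5) := by rw [← hv]; ring
    _ < _ := hG
    _ = _ := by rw [← hv]; ring

/-- The quadratic inequality equivalent to log-concavity, along the Riccati recurrence. -/
lemma riccati_quadratic_bound {ε : ℝ} (hε : 0 ≤ ε) (hε1 : ε ≤ 1) {z : ℕ → ℝ}
    (hz : ∀ n, 0 ≤ z n) (hz0 : z 0 = 0)
    (hrec : ∀ n : ℕ, (n + 2) * z (n + 1) * (1 + z n) = (n + 1) * (z n + ε)) (n : ℕ) :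
    ((n : ℝ) + 2) ^ 2 * (n + 4) * ε ≤
      (n + 3) + ((n + 2) ^ 2 + 4 * (n + 2) + 2) * z (n + 1) + (n + 3) ^ 3 * z (n + 1) ^ 2 ∧
    (1 ≤ n → ((n : ℝ) + 2) ^ 2 * (n + 4) * ε <
      (n + 3) + ((n + 2) ^ 2 + 4 * (n + 2) + 2) * z (n + 1) + (n + 3) ^ 3 * z (n + 1) ^ 2) := by
  induction n with
  | zero =>
    have h := hrec 0
    rw [hz0] at h
    push_cast at *
    refine ⟨?_, by simp⟩
    have hε' : ε = 2 * z (0 + 1) := by linarith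
    rw [hε']
    nlinarith [sq_nonneg (3 * z (0 + 1) - 1)]
  | succ n ih =>
    suffices h : ((n : ℝ) + 3) ^ 2 * (n + 5) * ε < (n + 4) +
        ((n + 3) ^ 2 + 4 * (n + 3) + 2) * z (n + 2) + (n + 4) ^ 3 * z (n + 2) ^ 2 by
      push_cast
      have h' : ((n : ℝ) + 1 + 2) ^ 2 * (n + 1 + 4) * ε < (n + 1 + 3) +
        ((n + 1 + 2) ^ 2 + 4 * (n + 1 + 2) + 2) * z (n + 1 + 1) +
          (n + 1 + 3) ^ 3 * z (n + 1 + 1) ^ 2 := by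
        ring_nf at h ⊢
        exact h
      exact ⟨h'.le, fun _ => h'⟩
    have hn : (0 : ℝ) ≤ n := n.cast_nonneg
    rcases le_or_gt (((n : ℝ) + 4) * z (n + 2)) 1 with hs | hs
    · have hlow := riccati_lower_bound hε hε1 hz hrec (n + 2)
      push_cast at hlow
      have := quadratic_bound_of_small (m := (n : ℝ) + 3) (ε := ε) (z := z (n + 2)) (by linarith)
        (hz _) (by linarith) (by linarith)
      linarith
    · have ih1 := ih.1
      have hr := hrec (n + 1)
      have hx := hz (n + 1)
      have hw := hz (n + 2)
      push_cast at hr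
      rw [show n + 1 + 1 = n + 2 from rfl] at hr
      generalize z (n + 2) = w at *
      generalize z (n + 1) = x at *
      clear ih hrec
      generalize (n : ℝ) = m at *
      obtain ⟨N, rfl⟩ : ∃ N : ℝ, m = N - 2 := ⟨m + 2, by ring⟩
      obtain ⟨T, hT⟩ : ∃ T, T = (2 * N + 1) - (N + 1) * (1 + w) := ⟨_, rfl⟩
      have hN0 : 0 < N := by linarith
      have hrT : (1 + x) * T = N * (1 - ε) := by
        rw [hT]
        linear_combination -hr
      have hT0 : 0 ≤ T := by
        refine nonneg_of_mul_nonneg_right (a := 1 + x) ?_ (by positivity)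
        rw [hrT]
        exact mul_nonneg hN0.le (by linarith)
      have h1 : 0 ≤ (N + 1) ^ 2 * (1 + x) - N * (N + 2) * (1 + w) := by
        refine nonneg_of_mul_nonneg_right (a := (1 + x) * (N + 1)) ?_ (by positivity)
        linear_combination ih1 + N * (N + 2) * hr
      have h2 : 0 ≤ (N + 1) ^ 2 * (1 - ε) - (N + 2) * (1 + w) * T := by
        refine nonneg_of_mul_nonneg_right (a := N) ?_ hN0
        linear_combination mul_nonneg h1 hT0 + (N + 1) ^ 2 * hrT
      have h3 : 0 < (1 + w) * ((N + 2) * w - 1) := mul_pos (by linarith) (by linarith)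
      rw [hT] at h2
      linear_combination (N + 3) * h2 + h3

lemma chooseSqSum_zero (a b : ℝ) : chooseSqSum a b 0 = 1 := by simp [chooseSqSum]

lemma chooseSqSum_one (a b : ℝ) : chooseSqSum a b 1 = a + b := by
  simp [chooseSqSum, Finset.sum_range_succ, add_comm]

lemma add_mul_chooseSqSum_le {a b : ℝ} (ha : 0 < a) (hb : 0 < b) (n : ℕ) :
    (a + b) * chooseSqSum a b n ≤ chooseSqSum a b (n + 1) := by
  induction n with
  | zero => simp [chooseSqSum_zero, chooseSqSum_one]
  | succ n ih =>
    have hr := chooseSqSum_recurrence (a := a) hb.ne' n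
    have h0 := chooseSqSum_pos ha hb n
    have hab : 0 < a * b := mul_pos ha hb
    refine le_of_mul_le_mul_left (a := (n : ℝ) + 2) ?_ (by positivity)
    rw [add_assoc, one_add_one_eq_two, hr]
    have h1 : 0 ≤ ((n : ℝ) + 1) * (a + b) *
        (chooseSqSum a b (n + 1) - (a + b) * chooseSqSum a b n) :=
      mul_nonneg (by positivity) (by linarith)
    have h2 : 0 ≤ ((n : ℝ) + 1) * (4 * (a * b)) * chooseSqSum a b n := by positivity
    linarith

lemma chooseSqSum_log_concave {a b : ℝ} (ha : 0 < a) (hb : 0 < b) (n : ℕ) :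
    ((n + 2) * chooseSqSum a b (n + 1)) * ((n + 4) * chooseSqSum a b (n + 3)) ≤
      ((n + 3) * chooseSqSum a b (n + 2)) ^ 2 ∧
    (1 ≤ n → ((n + 2) * chooseSqSum a b (n + 1)) * ((n + 4) * chooseSqSum a b (n + 3)) <
      ((n + 3) * chooseSqSum a b (n + 2)) ^ 2) := by
  have hs : 0 < a + b := by positivity
  have hab : 0 < a * b := mul_pos ha hb
  obtain ⟨ε, hεdef⟩ : ∃ ε, ε = 4 * (a * b) / (a + b) ^ 2 := ⟨_, rfl⟩
  have hε : 0 ≤ ε := by rw [hεdef]; positivity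
  have hε1 : ε ≤ 1 := by
    rw [hεdef, div_le_one (by positivity)]
    nlinarith [sq_nonneg (a - b)]
  have hd : (b - a) ^ 2 = (a + b) ^ 2 * (1 - ε) := by
    rw [hεdef]
    field_simp
    ring
  have hpos := chooseSqSum_pos ha hb
  have hrec := chooseSqSum_recurrence (a := a) hb.ne'
  rw [hd] at hrec
  obtain ⟨z, hzdef⟩ : ∃ z : ℕ → ℝ, ∀ n,
      chooseSqSum a b (n + 1) = (a + b) * chooseSqSum a b n * (1 + z n) :=
    ⟨fun n => chooseSqSum a b (n + 1) / ((a + b) * chooseSqSum a b n) - 1, fun n => by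
      have := (hpos n).ne'
      field_simp
      ring⟩
  have hz : ∀ n, 0 ≤ z n := fun n => by
    have h := add_mul_chooseSqSum_le ha hb n
    rw [hzdef] at h
    have := mul_pos hs (hpos n)
    by_contra! hneg
    nlinarith
  have hz0 : z 0 = 0 := by
    have h := hzdef 0
    rw [zero_add, chooseSqSum_one, chooseSqSum_zero, mul_one] at h
    exact mul_left_cancel₀ hs.ne' (by linarith)
  have hzrec : ∀ n : ℕ, (n + 2) * z (n + 1) * (1 + z n) = (n + 1) * (z n + ε) := fun n => by
    have h := hrec n
    rw [hzdef (n + 1), hzdef n] at h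
    have : (a + b) ^ 2 * chooseSqSum a b n ≠ 0 := by
      have := hpos n
      positivity
    apply mul_left_cancel₀ this
    linear_combination h
  have hQ := riccati_quadratic_bound hε hε1 hz hz0 hzrec n
  have h3 := hrec (n + 1)
  rw [show n + 1 + 2 = n + 3 from rfl, show n + 1 + 1 = n + 2 from rfl, hzdef (n + 1)] at h3
  rw [hzdef (n + 1)]
  have hf := hpos (n + 1)
  push_cast at h3
  generalize chooseSqSum a b (n + 1) = f at *
  generalize chooseSqSum a b (n + 3) = g at *
  generalize z (n + 1) = x at *
  have hn : (0 : ℝ) ≤ n := n.cast_nonneg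
  generalize hN : (n : ℝ) = N at *
  have hdiff : (N + 3) * (((N + 3) * ((a + b) * f * (1 + x))) ^ 2 -
        (N + 2) * f * ((N + 4) * g)) =
      ((a + b) * f) ^ 2 * ((N + 3) + ((N + 2) ^ 2 + 4 * (N + 2) + 2) * x +
        (N + 3) ^ 3 * x ^ 2 - (N + 2) ^ 2 * (N + 4) * ε) := by
    linear_combination -(N + 2) * (N + 4) * f * h3
  have hN3 : 0 < N + 3 := by linarith
  have hc : 0 < ((a + b) * f) ^ 2 := by positivity
  refine ⟨?_, fun h => ?_⟩
  · rw [← sub_nonneg]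
    refine nonneg_of_mul_nonneg_right (a := N + 3) ?_ hN3
    rw [hdiff]
    exact mul_nonneg hc.le (sub_nonneg.2 hQ.1)
  · rw [← sub_pos]
    refine pos_of_mul_pos_right (a := N + 3) ?_ hN3.le
    rw [hdiff]
    exact mul_pos hc (sub_pos.2 (hQ.2 h))

/-- A positive log-concave sequence is unimodal. -/
lemma min_le_of_log_concave {ψ : ℕ → ℝ} (hpos : ∀ n, 0 < ψ n)
    (hlc : ∀ n, 1 ≤ n → ψ n * ψ (n + 2) ≤ ψ (n + 1) ^ 2) {a b c : ℕ}
    (ha : 1 ≤ a) (hab : a ≤ b) (hbc : b ≤ c) : min (ψ a) (ψ c) ≤ ψ b := by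
  have hstep : ∀ n, 1 ≤ n → ψ (n + 1) ≤ ψ n → ψ (n + 2) ≤ ψ (n + 1) := fun n hn h => by
    refine le_of_mul_le_mul_left (a := ψ n) ?_ (hpos n)
    nlinarith [hlc n hn, hpos (n + 1)]
  have hanti : ∀ i, 1 ≤ i → ψ (i + 1) ≤ ψ i → ∀ j, i ≤ j → ψ (j + 1) ≤ ψ j := by
    intro i hi h j hj
    induction j, hj using Nat.le_induction with
    | base => exact h
    | succ j hj ih => exact hstep j (hi.trans hj) ih
  by_cases h : ∃ i, a ≤ i ∧ i < b ∧ ψ (i + 1) ≤ ψ i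
  · obtain ⟨i, hai, hib, hi⟩ := h
    refine (min_le_right _ _).trans ?_
    induction c, hbc using Nat.le_induction with
    | base => exact le_rfl
    | succ c hbc ih => exact (hanti i (ha.trans hai) hi c (hib.le.trans hbc)).trans ih
  · push Not at h
    refine (min_le_left _ _).trans ?_
    clear hbc
    induction b, hab using Nat.le_induction with
    | base => exact le_rfl
    | succ b hab ih =>
      exact (ih fun i h1 h2 => h i h1 (by omega)).trans (h b hab (by omega)).le

/-- For `θ₀, θ₁ ∈ (0,1)` and
`ψ(n) = ∑_{k=0}^n C(n,k) θ₁^k (1−θ₁)^{n−k} · (θ₀^k (1−θ₀)^{n−k} / ∫₀¹ t^k (1−t)^{n−k} dt)`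
(the expected `θ₀`-posterior after `n` iid Bernoulli observations generated under `θ₁`, with
a uniform prior on `(0,1)`), the sequence `ψ` is log-concave for `n ≥ 1` and strictly
log-concave for `n ≥ 2`; in particular it is unimodal (quasiconcave) on `{n ≥ 1}`. -/
theorem bernoulli_uniform_prior_log_concave
    (θ₀ θ₁ : ℝ) (hθ₀ : θ₀ ∈ Set.Ioo (0:ℝ) 1) (hθ₁ : θ₁ ∈ Set.Ioo (0:ℝ) 1)
    (ψ : ℕ → ℝ)
    (hψ : ∀ n : ℕ, ψ n = ∑ k ∈ Finset.range (n + 1),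
      (n.choose k : ℝ) * θ₁ ^ k * (1 - θ₁) ^ (n - k) *
        (θ₀ ^ k * (1 - θ₀) ^ (n - k) / ∫ t in (0:ℝ)..1, t ^ k * (1 - t) ^ (n - k))) :
    (∀ n : ℕ, 2 ≤ n → ψ (n - 1) * ψ (n + 1) ≤ ψ n ^ 2) ∧
    (∀ n : ℕ, 3 ≤ n → ψ (n - 1) * ψ (n + 1) < ψ n ^ 2) ∧
    (∀ a b c : ℕ, 1 ≤ a → a ≤ b → b ≤ c → min (ψ a) (ψ c) ≤ ψ b) := by
  obtain ⟨h0, h0'⟩ := hθ₀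
  obtain ⟨h1, h1'⟩ := hθ₁
  have ha : 0 < θ₀ * θ₁ := mul_pos h0 h1
  have hb : 0 < (1 - θ₀) * (1 - θ₁) := mul_pos (by linarith) (by linarith)
  have hψ' : ∀ n : ℕ, ψ n = (n + 1) * chooseSqSum (θ₀ * θ₁) ((1 - θ₀) * (1 - θ₁)) n := fun n => by
    rw [hψ, chooseSqSum, Finset.mul_sum]
    refine Finset.sum_congr rfl fun k hk => ?_
    have hkn : k ≤ n := by simpa [Nat.lt_succ_iff] using hk
    have hI := integral_pow_mul_one_sub_pow (n - k) k
    rw [Nat.cast_sub hkn, Nat.add_sub_cancel' hkn, add_sub_cancel] at hI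
    rw [div_eq_mul_inv, ← eq_inv_of_mul_eq_one_left hI, mul_pow, mul_pow]
    ring
  have hlc : ∀ n : ℕ, ψ (n + 1) * ψ (n + 3) ≤ ψ (n + 2) ^ 2 ∧
      (1 ≤ n → ψ (n + 1) * ψ (n + 3) < ψ (n + 2) ^ 2) := fun n => by
    have h := chooseSqSum_log_concave ha hb n
    simp only [hψ']
    push_cast
    ring_nf at h ⊢
    exact h
  refine ⟨fun n hn => ?_, fun n hn => ?_, fun a b c => min_le_of_log_concave (fun n => ?_) ?_⟩
  · obtain ⟨n, rfl⟩ := Nat.exists_eq_add_of_le' hn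
    exact (hlc n).1
  · obtain ⟨n, rfl⟩ := Nat.exists_eq_add_of_le' hn
    exact (hlc (n + 1)).2 (by omega)
  · rw [hψ']
    exact mul_pos (by positivity) (chooseSqSum_pos ha hb n)
  · intro n hn
    obtain ⟨n, rfl⟩ := Nat.exists_eq_add_of_le' hn
    exact (hlc n).1
end

section
/- For each integer n ≥ 0 let P_n be the Legendre polynomial, P_n(x) = 2^{−n} ∑_{k=0}^{n} C(n,k)² (x−1)^{n−k} (x+1)^k. Then for every integer n ≥ 2 and every real x with |x| > 1, n(n+2) · P_{n−1}(x) · P_{n+1}(x) ≤ (n+1)² · P_n(x)², with equality if and only if n = 2 and |x| = √3. -/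
/-- The sum of squares of binomial coefficients, weighted by powers of `w`, satisfies a three-term
recurrence. -/
theorem sum_choose_sq_recurrence (n : ℕ) (w : ℝ) :
    ((n : ℝ) + 2) * ∑ k ∈ Finset.range (n + 3), ((n + 2).choose k : ℝ) ^ 2 * w ^ k =
      (2 * n + 3) * (1 + w) * ∑ k ∈ Finset.range (n + 2), ((n + 1).choose k : ℝ) ^ 2 * w ^ k -
      (n + 1) * (w - 1) ^ 2 * ∑ k ∈ Finset.range (n + 1), (n.choose k : ℝ) ^ 2 * w ^ k := by
  have h0 : ∀ m j : ℕ, ∑ k ∈ Finset.range (m + 1), (m.choose k : ℝ) ^ 2 * w ^ k =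
      ∑ k ∈ Finset.range (m + 1 + j), (m.choose k : ℝ) ^ 2 * w ^ k := by
    intro m j
    refine Finset.sum_subset (Finset.range_mono (by omega)) fun k _ hk => ?_
    rw [Nat.choose_eq_zero_of_lt (by simpa using hk)]
    simp
  have hshift : ∀ (f : ℕ → ℝ) (N : ℕ), w * ∑ k ∈ Finset.range N, f k * w ^ k =
      ∑ k ∈ Finset.range N, f k * w ^ (k + 1) := by
    intro f N
    rw [Finset.mul_sum]
    exact Finset.sum_congr rfl fun k _ => by ring
  have hshift₂ : ∀ (f : ℕ → ℝ) (N : ℕ), w ^ 2 * ∑ k ∈ Finset.range N, f k * w ^ k =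
      ∑ k ∈ Finset.range N, f k * w ^ (k + 2) := by
    intro f N
    rw [Finset.mul_sum]
    exact Finset.sum_congr rfl fun k _ => by ring
  have hA := Finset.sum_range_succ' (fun k => ((n + 2).choose k : ℝ) ^ 2 * w ^ k) (n + 2)
  have hA₂ := Finset.sum_range_succ' (fun k => ((n + 2).choose (k + 1) : ℝ) ^ 2 * w ^ (k + 1))
    (n + 1)
  have hB := (h0 (n + 1) 1).trans
    (Finset.sum_range_succ' (fun k => ((n + 1).choose k : ℝ) ^ 2 * w ^ k) (n + 2))
  have hB₂ := Finset.sum_range_succ' (fun k => ((n + 1).choose (k + 1) : ℝ) ^ 2 * w ^ (k + 1))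
    (n + 1)
  have hwB := (hshift (fun k => ((n + 1).choose k : ℝ) ^ 2) (n + 2)).trans
    (Finset.sum_range_succ' (fun k => ((n + 1).choose k : ℝ) ^ 2 * w ^ (k + 1)) (n + 1))
  have hC := (h0 n 2).trans
    (Finset.sum_range_succ' (fun k => (n.choose k : ℝ) ^ 2 * w ^ k) (n + 2))
  have hC₂ := Finset.sum_range_succ' (fun k => (n.choose (k + 1) : ℝ) ^ 2 * w ^ (k + 1)) (n + 1)
  have hwC := (congrArg (w * ·) (h0 n 1)).trans
    ((hshift (fun k => (n.choose k : ℝ) ^ 2) (n + 2)).trans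
    (Finset.sum_range_succ' (fun k => (n.choose k : ℝ) ^ 2 * w ^ (k + 1)) (n + 1)))
  have hwwC := hshift₂ (fun k => (n.choose k : ℝ) ^ 2) (n + 1)
  have hcoef : ∀ k : ℕ, ((n : ℝ) + 2) * ((n + 2).choose (k + 2) : ℝ) ^ 2 =
      (2 * n + 3) * (((n + 1).choose (k + 2) : ℝ) ^ 2 + ((n + 1).choose (k + 1) : ℝ) ^ 2) -
      (n + 1) * ((n.choose k : ℝ) ^ 2 - 2 * (n.choose (k + 1) : ℝ) ^ 2 +
        (n.choose (k + 2) : ℝ) ^ 2) := by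
    intro k
    have e : ∀ i : ℕ, ((i : ℝ) + 1) * (n.choose (i + 1) : ℝ) = (n - i) * (n.choose i : ℝ) := by
      intro i
      rcases le_or_gt i n with h | h
      · have := Nat.choose_succ_right_eq n i
        rw [← Nat.cast_sub h]
        exact_mod_cast (by linarith : (i + 1) * n.choose (i + 1) = (n - i) * n.choose i)
      · rw [Nat.choose_eq_zero_of_lt h, Nat.choose_eq_zero_of_lt (by omega)]
        simp
    have e1 := e k
    have e2 := e (k + 1)
    simp only [Nat.choose_succ_succ' (n + 1), Nat.choose_succ_succ' n]
    push_cast at e2 ⊢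
    generalize (n.choose k : ℝ) = a at *
    generalize (n.choose (k + 1) : ℝ) = b at *
    generalize (n.choose (k + 1 + 1) : ℝ) = c at *
    linear_combination 2 * ((-c - b) * e1 + (a + b) * e2)
  have hsum : ((n : ℝ) + 2) * ∑ k ∈ Finset.range (n + 1),
        ((n + 2).choose (k + 1 + 1) : ℝ) ^ 2 * w ^ (k + 1 + 1) =
      (2 * n + 3) * (∑ k ∈ Finset.range (n + 1),
          ((n + 1).choose (k + 1 + 1) : ℝ) ^ 2 * w ^ (k + 1 + 1) +
        ∑ k ∈ Finset.range (n + 1), ((n + 1).choose (k + 1) : ℝ) ^ 2 * w ^ (k + 1 + 1)) -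
      (n + 1) * (∑ k ∈ Finset.range (n + 1), (n.choose k : ℝ) ^ 2 * w ^ (k + 2) -
        2 * ∑ k ∈ Finset.range (n + 1), (n.choose (k + 1) : ℝ) ^ 2 * w ^ (k + 1 + 1) +
        ∑ k ∈ Finset.range (n + 1), (n.choose (k + 1 + 1) : ℝ) ^ 2 * w ^ (k + 1 + 1)) := by
    simp only [Finset.mul_sum, ← Finset.sum_add_distrib, ← Finset.sum_sub_distrib]
    exact Finset.sum_congr rfl fun k _ => by linear_combination w ^ (k + 2) * hcoef k
  simp only [Nat.choose_zero_right, zero_add, Nat.choose_one_right, pow_zero, pow_one] at *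
  push_cast at *
  linear_combination (n + 2) * (hA + hA₂) + hsum - (2 * n + 3) * (hB + hB₂ + hwB)
    + (n + 1) * (hC + hC₂ - 2 * hwC + hwwC)

/-- Bonnet's recurrence for the Legendre polynomials. -/
theorem legendre_recurrence (P : ℕ → ℝ → ℝ)
    (hP : ∀ (n : ℕ) (x : ℝ), P n x =
      (1 / 2 ^ n) * ∑ k ∈ Finset.range (n + 1),
        (n.choose k : ℝ) ^ 2 * (x - 1) ^ (n - k) * (x + 1) ^ k)
    (n : ℕ) {x : ℝ} (hx : x ≠ 1) :
    ((n : ℝ) + 2) * P (n + 2) x = (2 * n + 3) * x * P (n + 1) x - (n + 1) * P n x := by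
  have hx' : x - 1 ≠ 0 := sub_ne_zero.mpr hx
  have hQ : ∀ m : ℕ, P m x = ((x - 1) / 2) ^ m *
      ∑ k ∈ Finset.range (m + 1), (m.choose k : ℝ) ^ 2 * ((x + 1) / (x - 1)) ^ k := by
    intro m
    rw [hP, div_pow (x - 1), div_mul_eq_mul_div, one_mul, div_mul_eq_mul_div, Finset.mul_sum]
    congr 1
    refine Finset.sum_congr rfl fun k hk => ?_
    have hk' : k ≤ m := by simpa [Nat.lt_succ_iff] using hk
    rw [← Nat.sub_add_cancel hk', pow_add (x - 1), Nat.add_sub_cancel, div_pow]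
    field_simp
  have h := sum_choose_sq_recurrence n ((x + 1) / (x - 1))
  obtain ⟨S₀, hS₀⟩ : ∃ S, S = ∑ k ∈ Finset.range (n + 1),
    (n.choose k : ℝ) ^ 2 * ((x + 1) / (x - 1)) ^ k := ⟨_, rfl⟩
  obtain ⟨S₁, hS₁⟩ : ∃ S, S = ∑ k ∈ Finset.range (n + 2),
    ((n + 1).choose k : ℝ) ^ 2 * ((x + 1) / (x - 1)) ^ k := ⟨_, rfl⟩
  rw [hQ, hQ, hQ, ← hS₀, ← hS₁]
  rw [← hS₀, ← hS₁] at h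
  have h1 : 1 + (x + 1) / (x - 1) = x * (2 / (x - 1)) := by field_simp; ring
  have h2 : ((x + 1) / (x - 1) - 1) ^ 2 = (2 / (x - 1)) ^ 2 := by field_simp; ring
  rw [h1, h2] at h
  have h3 : (x - 1) / 2 * (2 / (x - 1)) = 1 := by field_simp
  generalize (x - 1) / 2 = r at *
  generalize 2 / (x - 1) = s at *
  have h4 : r ^ 2 * s ^ 2 = 1 := by rw [← mul_pow, h3, one_pow]
  linear_combination r ^ (n + 2) * h + (2 * n + 3) * x * r ^ (n + 1) * S₁ * h3
    - (n + 1) * r ^ n * S₀ * h4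

/-- Legendre polynomials have the parity of their degree. -/
theorem legendre_neg (P : ℕ → ℝ → ℝ)
    (hP : ∀ (n : ℕ) (x : ℝ), P n x =
      (1 / 2 ^ n) * ∑ k ∈ Finset.range (n + 1),
        (n.choose k : ℝ) ^ 2 * (x - 1) ^ (n - k) * (x + 1) ^ k)
    (n : ℕ) (x : ℝ) : P n (-x) = (-1) ^ n * P n x := by
  rw [hP, hP, mul_left_comm, ← Finset.sum_range_reflect]
  congr 1
  rw [Finset.mul_sum]
  refine Finset.sum_congr rfl fun k hk => ?_
  have hk' : k ≤ n := by simpa [Nat.lt_succ_iff] using hk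
  rw [show n + 1 - 1 - k = n - k by omega, show n - (n - k) = k by omega, Nat.choose_symm hk',
    show -x - 1 = -1 * (x + 1) by ring, show -x + 1 = -1 * (x - 1) by ring, mul_pow, mul_pow,
    show (-1 : ℝ) ^ n = (-1) ^ k * (-1) ^ (n - k) by rw [← pow_add]; congr 1; omega]
  ring

/-- A rational lower bound for the ratio of consecutive solutions of Bonnet's recurrence. -/
theorem bonnet_ratio_lower_bound {p : ℕ → ℝ} {t : ℝ} (ht : 0 < t)
    (h0 : p 0 = 1) (h1 : p 1 = 1 + 2 * t)
    (hrec : ∀ n : ℕ, ((n : ℝ) + 2) * p (n + 2) =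
      (2 * n + 3) * (1 + 2 * t) * p (n + 1) - (n + 1) * p n) (n : ℕ) :
    0 < p n ∧ ((1 + 2 * t) * (2 + (n ^ 2 + n + 2) * t) + 4 * n * t * (t + 1)) * p n ≤
      (2 + (n ^ 2 + n + 2) * t) * p (n + 1) := by
  induction n with
  | zero => simp only [h0, h1, zero_add]; push_cast; constructor <;> nlinarith
  | succ n ih =>
    obtain ⟨hp, hle⟩ := ih
    have hr := hrec n
    push_cast
    have hn : (0 : ℝ) ≤ n := n.cast_nonneg
    have hkey : (n + 2) * ((1 + 2 * t) * (2 + ((n + 1) ^ 2 + (n + 1) + 2) * t) +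
          4 * (n + 1) * t * (t + 1)) *
        ((1 + 2 * t) * (2 + ((n : ℝ) ^ 2 + n + 2) * t) + 4 * n * t * (t + 1)) ≤
        ((2 * n + 3) * (1 + 2 * t) *
          ((1 + 2 * t) * (2 + ((n : ℝ) ^ 2 + n + 2) * t) + 4 * n * t * (t + 1)) -
          (n + 1) * (2 + ((n : ℝ) ^ 2 + n + 2) * t)) *
        (2 + ((n + 1) ^ 2 + (n + 1) + 2) * t) := by
      rw [← sub_nonneg]
      ring_nf
      positivity
    have hN : 0 < (1 + 2 * t) * (2 + ((n : ℝ) ^ 2 + n + 2) * t) + 4 * n * t * (t + 1) := by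
      positivity
    have hM : 0 < 2 + ((n : ℝ) ^ 2 + n + 2) * t := by positivity
    have hM1 : 0 < 2 + (((n : ℝ) + 1) ^ 2 + (n + 1) + 2) * t := by positivity
    have hp1 : 0 < p (n + 1) := pos_of_mul_pos_right ((mul_pos hN hp).trans_le hle) hM.le
    refine ⟨hp1, ?_⟩
    generalize (1 + 2 * t) * (2 + (((n : ℝ) + 1) ^ 2 + (n + 1) + 2) * t) +
          4 * (n + 1) * t * (t + 1) = N₁ at *
    generalize 2 + (((n : ℝ) + 1) ^ 2 + (n + 1) + 2) * t = M₁ at *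
    generalize (1 + 2 * t) * (2 + ((n : ℝ) ^ 2 + n + 2) * t) + 4 * n * t * (t + 1) = N at *
    generalize 2 + ((n : ℝ) ^ 2 + n + 2) * t = M at *
    have hc : 0 < (n + 2) * N := by positivity
    refine le_of_mul_le_mul_left ?_ hc
    have ha := mul_le_mul_of_nonneg_right hkey hp1.le
    have hb := mul_le_mul_of_nonneg_left hle (by positivity : 0 ≤ (n + 1) * M₁)
    have he : (n + 2) * N * (M₁ * p (n + 1 + 1)) =
      N * M₁ * ((2 * n + 3) * (1 + 2 * t) * p (n + 1) - (n + 1) * p n) := by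
      rw [← hr]; ring
    rw [he]
    linarith

/-- The reversed Turán expression is positive when the ratio `b / a` obeys the rational lower
bound and `t` is small. -/
theorem turan_form_pos_of_small {n t a b : ℝ} (hn : 2 ≤ n) (ht : 0 < t)
    (htn : (n ^ 2 + n + 2) * t ≤ 1) (ha : 0 < a)
    (hab : ((1 + 2 * t) * (2 + (n ^ 2 + n + 2) * t) + 4 * n * t * (t + 1)) * a ≤
      (2 + (n ^ 2 + n + 2) * t) * b) :
    0 < (n + 2) ^ 3 * b ^ 2 - (n + 1) * (n + 3) * (2 * n + 3) * (1 + 2 * t) * a * b +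
      (n + 1) ^ 2 * (n + 3) * a ^ 2 := by
  obtain ⟨m, hm, rfl⟩ : ∃ m : ℝ, 0 ≤ m ∧ n = m + 2 := ⟨n - 2, by linarith, by ring⟩
  have hW : 0 < (m + 2) ^ 2 + (m + 2) + 2 := by positivity
  obtain ⟨z, hz, rfl⟩ : ∃ z : ℝ, 0 ≤ z ∧ t = 1 / (((m + 2) ^ 2 + (m + 2) + 2) * (1 + z)) := by
    refine ⟨1 / (((m + 2) ^ 2 + (m + 2) + 2) * t) - 1, ?_, ?_⟩
    · rw [sub_nonneg, le_div_iff₀ (by positivity)]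
      linarith
    · field_simp
      ring
  set t := 1 / (((m + 2) ^ 2 + (m + 2) + 2) * (1 + z)) with hts
  set S := ((m + 2) ^ 2 + (m + 2) + 2) * (1 + z) with hS
  have hSpos : 0 < S := by positivity
  have hSt : S * t = 1 := by rw [hts]; field_simp
  set M := 2 + ((m + 2) ^ 2 + (m + 2) + 2) * t with hM
  set N := (1 + 2 * t) * M + 4 * (m + 2) * t * (t + 1) with hN
  have hMpos : 0 < M := by positivity
  have hNpos : 0 < N := by positivity
  have hMS : S * M = 2 * S + ((m + 2) ^ 2 + (m + 2) + 2) := by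
    rw [hM]; linear_combination ((m + 2) ^ 2 + (m + 2) + 2) * hSt
  have hxS : S * (1 + 2 * t) = S + 2 := by linear_combination 2 * hSt
  have hNS : S ^ 2 * N = (S + 2) * (2 * S + ((m + 2) ^ 2 + (m + 2) + 2)) +
      4 * (m + 2) * (1 + S) := by
    rw [← hMS, ← hxS, hN]
    linear_combination (4 * (m + 2) * (1 + S * t + S)) * hSt
  have hbound : 0 < (m + 2 + 2) ^ 3 * N ^ 2 -
      (m + 2 + 1) * (m + 2 + 3) * (2 * (m + 2) + 3) * (1 + 2 * t) * N * M +
      (m + 2 + 1) ^ 2 * (m + 2 + 3) * M ^ 2 := by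
    refine pos_of_mul_pos_right (a := S ^ 4) ?_ (by positivity)
    rw [show S ^ 4 * ((m + 2 + 2) ^ 3 * N ^ 2 -
      (m + 2 + 1) * (m + 2 + 3) * (2 * (m + 2) + 3) * (1 + 2 * t) * N * M +
      (m + 2 + 1) ^ 2 * (m + 2 + 3) * M ^ 2) = (m + 2 + 2) ^ 3 * (S ^ 2 * N) ^ 2 -
      (m + 2 + 1) * (m + 2 + 3) * (2 * (m + 2) + 3) * (S * (1 + 2 * t)) * (S ^ 2 * N) * (S * M) +
      (m + 2 + 1) ^ 2 * (m + 2 + 3) * (S * M) ^ 2 * S ^ 2 by ring, hNS, hxS, hMS, hS]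
    ring_nf
    positivity
  have hslope : 0 < 2 * (m + 2 + 2) ^ 3 * N -
      (m + 2 + 1) * (m + 2 + 3) * (2 * (m + 2) + 3) * (1 + 2 * t) * M := by
    refine pos_of_mul_pos_right (a := S ^ 2) ?_ (by positivity)
    rw [show S ^ 2 * (2 * (m + 2 + 2) ^ 3 * N -
      (m + 2 + 1) * (m + 2 + 3) * (2 * (m + 2) + 3) * (1 + 2 * t) * M) =
      2 * (m + 2 + 2) ^ 3 * (S ^ 2 * N) -
      (m + 2 + 1) * (m + 2 + 3) * (2 * (m + 2) + 3) * (S * (1 + 2 * t)) * (S * M) by ring,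
      hNS, hxS, hMS, hS]
    ring_nf
    positivity
  refine pos_of_mul_pos_right (a := M ^ 2) ?_ (by positivity)
  have hA : 0 ≤ (m + 2 + 2) ^ 3 := by positivity
  generalize (m + 2 + 2) ^ 3 = A at *
  generalize (m + 2 + 1) * (m + 2 + 3) * (2 * (m + 2) + 3) * (1 + 2 * t) = B at *
  have hd : 0 ≤ M * b - N * a := sub_nonneg.mpr hab
  have h1 := mul_pos (pow_pos ha 2) hbound
  have h2 := mul_nonneg hd (mul_pos ha hslope).le
  have h3 := mul_nonneg hA (mul_nonneg hd hd)
  linear_combination h1 + h2 + h3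

/-- A lower bound for `(b / a) ^ 2` when the ratio `b / a` obeys the rational lower bound and `t`
is not small. -/
theorem sq_ratio_bound_of_large {n t a b : ℝ} (hn : 2 ≤ n)
    (htn : 1 ≤ (n ^ 2 + n + 2) * t) (ha : 0 < a)
    (hab : ((1 + 2 * t) * (2 + (n ^ 2 + n + 2) * t) + 4 * n * t * (t + 1)) * a ≤
      (2 + (n ^ 2 + n + 2) * t) * b) :
    (n + 1) ^ 2 * (n + 3) * a ^ 2 < (n + 2) * (n ^ 2 + n - 1) * b ^ 2 := by
  obtain ⟨m, hm, rfl⟩ : ∃ m : ℝ, 0 ≤ m ∧ n = m + 2 := ⟨n - 2, by linarith, by ring⟩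
  have hW : 0 < (m + 2) ^ 2 + (m + 2) + 2 := by positivity
  set W := (m + 2) ^ 2 + (m + 2) + 2 with hWdef
  obtain ⟨s, hs, rfl⟩ : ∃ s : ℝ, 0 ≤ s ∧ t = (1 + s) / W :=
    ⟨W * t - 1, by linarith, by field_simp; ring⟩
  set M := 2 + W * ((1 + s) / W) with hM
  set N := (1 + 2 * ((1 + s) / W)) * M + 4 * (m + 2) * ((1 + s) / W) * ((1 + s) / W + 1) with hN
  have hMs : M = 3 + s := by rw [hM]; field_simp; ring
  have hMpos : 0 < M := by positivity
  have hNpos : 0 < N := by positivity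
  have hNW : W ^ 2 * N = (W + 2 * (1 + s)) * W * (3 + s) + 4 * (m + 2) * (1 + s) * (1 + s + W) := by
    rw [hN, hMs]; field_simp
  have hbound : 0 < (m + 2 + 2) * ((m + 2) ^ 2 + (m + 2) - 1) * N ^ 2 -
      (m + 2 + 1) ^ 2 * (m + 2 + 3) * M ^ 2 := by
    refine pos_of_mul_pos_right (a := W ^ 4) ?_ (by positivity)
    rw [show W ^ 4 * ((m + 2 + 2) * ((m + 2) ^ 2 + (m + 2) - 1) * N ^ 2 -
      (m + 2 + 1) ^ 2 * (m + 2 + 3) * M ^ 2) =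
      (m + 2 + 2) * ((m + 2) ^ 2 + (m + 2) - 1) * (W ^ 2 * N) ^ 2 -
      (m + 2 + 1) ^ 2 * (m + 2 + 3) * M ^ 2 * W ^ 4 by ring, hNW, hMs, hWdef]
    ring_nf
    positivity
  have hsq : (N * a) ^ 2 ≤ (M * b) ^ 2 := pow_le_pow_left₀ (by positivity) hab 2
  have hc : 0 ≤ (m + 2 + 2) * ((m + 2) ^ 2 + (m + 2) - 1) := by
    have : 0 ≤ (m + 2) ^ 2 + (m + 2) - 1 := by nlinarith
    positivity
  refine lt_of_mul_lt_mul_left (a := M ^ 2) ?_ (by positivity)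
  have h1 := mul_pos (pow_pos ha 2) hbound
  have h2 := mul_le_mul_of_nonneg_left hsq hc
  linarith

/-- The reversed Turán inequality propagates along Bonnet's recurrence and becomes strict. -/
theorem bonnet_turan_succ {p : ℕ → ℝ} {t : ℝ} (ht : 0 < t)
    (h0 : p 0 = 1) (h1 : p 1 = 1 + 2 * t)
    (hrec : ∀ n : ℕ, ((n : ℝ) + 2) * p (n + 2) =
      (2 * n + 3) * (1 + 2 * t) * p (n + 1) - (n + 1) * p n) {n : ℕ} (hn : 1 ≤ n)
    (hD : ((n : ℝ) + 1) * (n + 3) * (p n * p (n + 2)) ≤ (n + 2) ^ 2 * p (n + 1) ^ 2) :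
    ((n : ℝ) + 2) * (n + 4) * (p (n + 1) * p (n + 3)) < (n + 3) ^ 2 * p (n + 2) ^ 2 := by
  obtain ⟨ha, hab⟩ := bonnet_ratio_lower_bound ht h0 h1 hrec (n + 1)
  have hr0 := hrec n
  have hr1 := hrec (n + 1)
  have hn' : (1 : ℝ) ≤ n := by exact_mod_cast hn
  simp only [add_assoc, Nat.reduceAdd] at hab hr1
  push_cast at hab hr1
  generalize p n = c at *
  generalize p (n + 1) = a at *
  generalize p (n + 2) = b at *
  generalize p (n + 3) = d at *
  generalize (n : ℝ) = r at *
  obtain ⟨m, rfl⟩ : ∃ m : ℝ, r = m - 1 := ⟨r + 1, by ring⟩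
  have hm : 2 ≤ m := by linarith
  rw [← sub_pos]
  refine pos_of_mul_pos_right (a := m + 2) ?_ (by positivity)
  rcases le_total ((m ^ 2 + m + 2) * t) 1 with hs | hs
  · have := turan_form_pos_of_small (a := a) (b := b) hm ht hs ha (by convert hab using 1 <;> ring)
    linear_combination this + (m + 1) * (m + 3) * a * hr1
  · have := sq_ratio_bound_of_large (a := a) (b := b) hm hs ha (by convert hab using 1 <;> ring)
    refine pos_of_mul_pos_right (a := (m + 2) * (2 * m + 1)) ?_ (by positivity)
    have hD' := mul_le_mul_of_nonneg_left hD
      (by positivity : 0 ≤ (m + 1) * (m + 3) * (2 * m + 3))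
    linear_combination this + hD' - (m + 1) * (m + 3) * (2 * m + 3) * (m + 2) * b * hr0
      + (2 * m + 1) * (m + 2) * (m + 1) * (m + 3) * a * hr1


/-- For the Legendre polynomials
`P_n(x) = 2^{−n} ∑_{k=0}^n C(n,k)² (x−1)^{n−k} (x+1)^k`, for every `n ≥ 2` and every real
`x` with `|x| > 1`, `n(n+2) P_{n−1}(x) P_{n+1}(x) ≤ (n+1)² P_n(x)²`, with equality iff
`n = 2` and `|x| = √3`. -/
theorem legendre_reversed_turan
    (P : ℕ → ℝ → ℝ)
    (hP : ∀ (n : ℕ) (x : ℝ), P n x =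
      (1 / 2 ^ n) * ∑ k ∈ Finset.range (n + 1),
        (n.choose k : ℝ) ^ 2 * (x - 1) ^ (n - k) * (x + 1) ^ k)
    (n : ℕ) (hn : 2 ≤ n) (x : ℝ) (hx : 1 < |x|) :
    ((n : ℝ) * (n + 2)) * (P (n - 1) x * P (n + 1) x) ≤ ((n : ℝ) + 1) ^ 2 * P n x ^ 2 ∧
    (((n : ℝ) * (n + 2)) * (P (n - 1) x * P (n + 1) x) = ((n : ℝ) + 1) ^ 2 * P n x ^ 2 ↔
      n = 2 ∧ |x| = Real.sqrt 3) := by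
  have hsq : P n x ^ 2 = P n |x| ^ 2 := by
    rcases abs_choice x with h | h
    · rw [h]
    · rw [h, legendre_neg P hP, mul_pow, ← pow_mul, mul_comm n 2, pow_mul, neg_one_sq, one_pow,
        one_mul]
  have hprod : P (n - 1) x * P (n + 1) x = P (n - 1) |x| * P (n + 1) |x| := by
    rcases abs_choice x with h | h
    · rw [h]
    · rw [h, legendre_neg P hP, legendre_neg P hP, mul_mul_mul_comm, ← pow_add,
        show n - 1 + (n + 1) = 2 * n by omega, pow_mul, neg_one_sq, one_pow, one_mul]
  rw [hsq, hprod]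
  generalize |x| = y at hx
  clear hsq hprod x
  obtain ⟨t, ht, rfl⟩ : ∃ t : ℝ, 0 < t ∧ y = 1 + 2 * t := ⟨(y - 1) / 2, by linarith, by ring⟩
  set p : ℕ → ℝ := fun m => P m (1 + 2 * t) with hp
  have h0 : p 0 = 1 := by simp [hp, hP]
  have h1 : p 1 = 1 + 2 * t := by simp [hp, hP, Finset.sum_range_succ]; ring
  have hrec : ∀ m : ℕ, ((m : ℝ) + 2) * p (m + 2) =
      (2 * m + 3) * (1 + 2 * t) * p (m + 1) - (m + 1) * p m :=
    fun m => legendre_recurrence P hP m hx.ne'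
  have h2 : p 2 = (3 * (1 + 2 * t) ^ 2 - 1) / 2 := by
    have := hrec 0
    simp only [zero_add, h0, h1] at this
    push_cast at this
    linarith
  have h3 : p 3 = (5 * (1 + 2 * t) ^ 3 - 3 * (1 + 2 * t)) / 2 := by
    have := hrec 1
    simp only [Nat.reduceAdd, h1, h2] at this
    push_cast at this
    linarith
  have hbase : 9 * p 2 ^ 2 - 8 * (p 1 * p 3) = ((1 + 2 * t) ^ 2 - 3) ^ 2 / 4 := by
    rw [h1, h2, h3]; ring
  have hstrict : ∀ m : ℕ, 1 ≤ m →
      ((m : ℝ) + 2) * (m + 4) * (p (m + 1) * p (m + 3)) < (m + 3) ^ 2 * p (m + 2) ^ 2 := by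
    intro m hm
    induction m, hm using Nat.le_induction with
    | base =>
      refine bonnet_turan_succ ht h0 h1 hrec le_rfl ?_
      norm_num
      linarith [sq_nonneg ((1 + 2 * t) ^ 2 - 3)]
    | succ m hm ih =>
      refine bonnet_turan_succ ht h0 h1 hrec (by omega) ?_
      simp only [add_assoc, Nat.reduceAdd]
      push_cast
      linear_combination ih
  obtain rfl | ⟨m, hm, rfl⟩ : n = 2 ∨ ∃ m, 1 ≤ m ∧ n = m + 2 := by
    rcases hn.eq_or_lt with h | h
    · exact Or.inl h.symm
    · exact Or.inr ⟨n - 2, by omega, by omega⟩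
  · change (2 : ℕ) * ((2 : ℕ) + 2 : ℝ) * (p 1 * p 3) ≤ ((2 : ℕ) + 1) ^ 2 * p 2 ^ 2 ∧
      ((2 : ℕ) * ((2 : ℕ) + 2 : ℝ) * (p 1 * p 3) = ((2 : ℕ) + 1) ^ 2 * p 2 ^ 2 ↔ _)
    norm_num
    refine ⟨by linarith [sq_nonneg ((1 + 2 * t) ^ 2 - 3)], ?_⟩
    rw [eq_comm (b := √3), Real.sqrt_eq_iff_eq_sq (by norm_num) (by positivity)]
    constructor
    · intro h
      have : ((1 + 2 * t) ^ 2 - 3) ^ 2 = 0 := by linarith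
      linarith [pow_eq_zero_iff two_ne_zero |>.mp this]
    · intro h
      rw [← h] at hbase
      linarith
  · have h := hstrict m hm
    have h' : ((m + 2 : ℕ) : ℝ) * ((m + 2 : ℕ) + 2) * (P (m + 2 - 1) (1 + 2 * t) *
        P (m + 2 + 1) (1 + 2 * t)) < ((m + 2 : ℕ) + 1) ^ 2 * P (m + 2) (1 + 2 * t) ^ 2 := by
      change _ * (p (m + 1) * p (m + 3)) < _ * p (m + 2) ^ 2
      push_cast
      linear_combination h
    exact ⟨h'.le, fun he => absurd he h'.ne, fun he => absurd he.1 (by omega)⟩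
end

section
/- For fixed reals y, z ≥ 0 not both zero, define S_n(y,z) := (n+1) ∑_{k=0}^{n} C(n,k)² y^k z^{n−k} for integers n ≥ 0. Then the sequence S_n(y,z) is log-concave in n for n ≥ 1 and strictly log-concave for n ≥ 2; that is, S_n(y,z)² ≥ S_{n−1}(y,z) · S_{n+1}(y,z) for every n ≥ 2, with strict inequality for every n ≥ 3. -/
/-- The homogeneous polynomial `∑_{k ≤ n} c_k y^k z^(n-k)`. -/
def homogeneousSum (y z : ℝ) (n : ℕ) (c : ℕ → ℝ) : ℝ :=
  ∑ k ∈ Finset.range (n + 1), c k * y ^ k * z ^ (n - k)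

/-- The right shift of a sequence, with `0` inserted in front. -/
def rightShift (c : ℕ → ℝ) : ℕ → ℝ
  | 0 => 0
  | k + 1 => c k

lemma mul_homogeneousSum_left (y z : ℝ) (n : ℕ) (c : ℕ → ℝ) :
    y * homogeneousSum y z n c = homogeneousSum y z (n + 1) (rightShift c) := by
  unfold homogeneousSum
  rw [Finset.sum_range_succ' _ (n + 1), Finset.mul_sum]
  simp only [rightShift, zero_mul, add_zero]
  refine Finset.sum_congr rfl fun k _ => ?_
  rw [Nat.add_sub_add_right]
  ring

lemma mul_homogeneousSum_right (y z : ℝ) (n : ℕ) (c : ℕ → ℝ) (hc : c (n + 1) = 0) :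
    z * homogeneousSum y z n c = homogeneousSum y z (n + 1) c := by
  unfold homogeneousSum
  rw [Finset.sum_range_succ _ (n + 1), Finset.mul_sum, hc]
  simp only [zero_mul, add_zero]
  refine Finset.sum_congr rfl fun k hk => ?_
  rw [Nat.sub_add_comm (Finset.mem_range_succ_iff.mp hk)]
  ring

lemma choose_sq_recurrence (n k : ℕ) :
    ((n : ℝ) + 2) * ((n + 2).choose (k + 2) : ℝ) ^ 2 =
      (2 * n + 3) * (((n + 1).choose (k + 1) : ℝ) ^ 2 + ((n + 1).choose (k + 2) : ℝ) ^ 2) -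
      (n + 1) * ((n.choose k : ℝ) ^ 2 - 2 * (n.choose (k + 1) : ℝ) ^ 2 +
        (n.choose (k + 2) : ℝ) ^ 2) := by
  have key (j : ℕ) : (n.choose (j + 1) : ℝ) * (j + 1) = n.choose j * (n - j) := by
    rcases le_or_gt j n with h | h
    · have := Nat.choose_succ_right_eq n j
      rw [← Nat.cast_sub h]
      exact_mod_cast this
    · simp [Nat.choose_eq_zero_of_lt h, Nat.choose_eq_zero_of_lt (h.trans (Nat.lt_succ_self j))]
  have h₁ := key k
  have h₂ := key (k + 1)
  push_cast at h₂
  simp only [Nat.choose_succ_succ' (n + 1), Nat.choose_succ_succ' n]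
  push_cast
  generalize (n.choose k : ℝ) = a at *
  generalize (n.choose (k + 1) : ℝ) = b at *
  generalize (n.choose (k + 1 + 1) : ℝ) = c at *
  linear_combination (-2 * c - 2 * b) * h₁ + (2 * a + 2 * b) * h₂

/-- The three-term recurrence of the sums `∑ C(n,k)² y^k z^(n-k)`. -/
lemma homogeneousSum_choose_sq_recurrence (y z : ℝ) (n : ℕ) :
    ((n : ℝ) + 2) * homogeneousSum y z (n + 2) (fun k => ((n + 2).choose k : ℝ) ^ 2) =
      (2 * n + 3) * (y + z) *
        homogeneousSum y z (n + 1) (fun k => ((n + 1).choose k : ℝ) ^ 2) -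
      (n + 1) * (y - z) ^ 2 * homogeneousSum y z n (fun k => (n.choose k : ℝ) ^ 2) := by
  set c₀ : ℕ → ℝ := fun k => (n.choose k : ℝ) ^ 2
  set c₁ : ℕ → ℝ := fun k => ((n + 1).choose k : ℝ) ^ 2
  have h₁ : c₀ (n + 1) = 0 := by simp [c₀]
  have h₂ : c₀ (n + 2) = 0 := by simp [c₀, Nat.choose_eq_zero_of_lt]
  have h₃ : c₁ (n + 2) = 0 := by simp [c₁]
  have e₁ := mul_homogeneousSum_left y z (n + 1) c₁
  have e₂ := mul_homogeneousSum_right y z (n + 1) c₁ h₃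
  have e₃ := mul_homogeneousSum_left y z (n + 1) (rightShift c₀)
  have e₄ := mul_homogeneousSum_left y z (n + 1) c₀
  have e₅ := mul_homogeneousSum_right y z (n + 1) c₀ h₂
  rw [← mul_homogeneousSum_left] at e₃
  rw [← mul_homogeneousSum_right y z n c₀ h₁] at e₄ e₅
  have expand : (2 * (n : ℝ) + 3) * (y + z) * homogeneousSum y z (n + 1) c₁ -
      (n + 1) * (y - z) ^ 2 * homogeneousSum y z n c₀ =
      (2 * n + 3) * (homogeneousSum y z (n + 2) (rightShift c₁) +
        homogeneousSum y z (n + 2) c₁) -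
      (n + 1) * (homogeneousSum y z (n + 2) (rightShift (rightShift c₀)) -
        2 * homogeneousSum y z (n + 2) (rightShift c₀) + homogeneousSum y z (n + 2) c₀) := by
    rw [← e₁, ← e₂, ← e₃, ← e₄, ← e₅]
    ring
  rw [expand]
  unfold homogeneousSum
  simp only [← Finset.sum_add_distrib, ← Finset.sum_sub_distrib, Finset.mul_sum]
  refine Finset.sum_congr rfl fun k _ => ?_
  have hk : ((n : ℝ) + 2) * ((n + 2).choose k : ℝ) ^ 2 =
      (2 * n + 3) * (rightShift c₁ k + c₁ k) -
      (n + 1) * (rightShift (rightShift c₀) k - 2 * rightShift c₀ k + c₀ k) := by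
    match k with
    | 0 => simp [rightShift, c₀, c₁]; ring
    | 1 => simp [rightShift, c₀, c₁]; ring
    | k + 2 => exact choose_sq_recurrence n k
  linear_combination y ^ k * z ^ (n + 2 - k) * hk

/-- If `w = n (v + n δ) / (n + v)`, the bound `n (n - 1) δ ≤ v² + 2 v` passes to `w`. -/
lemma riccati_lower_bound_step {n δ v w : ℝ} (hn : 1 ≤ n) (hδ : δ ≤ 1) (hv : 0 ≤ v)
    (hw : w * (n + v) = n * (v + n * δ)) (h : n * (n - 1) * δ ≤ v ^ 2 + 2 * v) :
    (n + 1) * n * δ ≤ w ^ 2 + 2 * w := by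
  have hp : 0 < (n + v) ^ 2 := by positivity
  have e : (w ^ 2 + 2 * w - (n + 1) * n * δ) * (n + v) ^ 2 =
      n ^ 2 * ((1 - δ) * (v ^ 2 + 2 * v - n * (n - 1) * δ)) +
      n * ((v + n * δ) ^ 2 + (1 - δ) * v ^ 2) := by
    linear_combination (w * (n + v) + n * (v + n * δ) + 2 * (n + v)) * hw
  have hd : 0 ≤ 1 - δ := by linarith
  have h' : 0 ≤ v ^ 2 + 2 * v - n * (n - 1) * δ := by linarith
  have : 0 ≤ (w ^ 2 + 2 * w - (n + 1) * n * δ) * (n + v) ^ 2 := by rw [e]; positivity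
  nlinarith [nonneg_of_mul_nonneg_left this hp]

/-- If `w = n (v + n δ) / (n + v)`, the bound `4 n (n - 1) δ ≤ 4 v² + 6 v + 1` passes to `w`. -/
lemma riccati_upper_range_step {n δ v w : ℝ} (hn : 2 ≤ n) (hδ₀ : 0 ≤ δ) (hδ : δ ≤ 1)
    (hv : 0 ≤ v) (hvn : v ≤ n - 1) (hw : w * (n + v) = n * (v + n * δ))
    (h : n * (n - 1) * δ ≤ v ^ 2 + 2 * v)
    (h' : 4 * (n * (n - 1) * δ) ≤ 4 * v ^ 2 + 6 * v + 1) :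
    4 * ((n + 1) * n * δ) ≤ 4 * w ^ 2 + 6 * w + 1 := by
  have hp : 0 < (n + v) ^ 2 := by positivity
  have hd : 0 ≤ 1 - δ := by linarith
  have e : (4 * w ^ 2 + 6 * w + 1 - 4 * ((n + 1) * n * δ)) * (n + v) ^ 2 =
      (n ^ 2 * (1 - δ) + n / 2) * (4 * v ^ 2 + 6 * v + 1 - 4 * (n * (n - 1) * δ)) +
      (4 * n ^ 3 * δ ^ 2 + v ^ 2) + n * δ * (4 * v * (n - v) - n) +
      n * ((2 * v - 1) * (2 * v + 1 / 2)) := by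
    linear_combination (4 * (w * (n + v) + n * (v + n * δ)) + 6 * (n + v)) * hw
  have : 0 ≤ (4 * w ^ 2 + 6 * w + 1 - 4 * ((n + 1) * n * δ)) * (n + v) ^ 2 := by
    rcases le_total (1 / 2) v with hv2 | hv2
    · rw [e]
      have h₁ : 0 ≤ 4 * v ^ 2 + 6 * v + 1 - 4 * (n * (n - 1) * δ) := by linarith
      have h₂ : 0 ≤ 4 * v * (n - v) - n := by
        nlinarith [mul_nonneg (sub_nonneg.2 hv2) (sub_nonneg.2 hvn)]
      have h₃ : 0 ≤ 2 * v - 1 := by linarith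
      positivity
    · have e' : (4 * w ^ 2 + 6 * w + 1 - 4 * ((n + 1) * n * δ)) * (n + v) ^ 2 =
          (n ^ 2 * (1 - δ) + n / 2) * (4 * (v ^ 2 + 2 * v - n * (n - 1) * δ)) +
          (4 * n ^ 3 * δ ^ 2 + v ^ 2) +
          n * ((1 - 2 * v) * (n - 2 * v) - δ * (2 * n - 6 * n * v + 4 * v ^ 2)) := by
        rw [e]; ring
      have h₁ : 0 ≤ v ^ 2 + 2 * v - n * (n - 1) * δ := by linarith
      have h₂ : n * δ ≤ 5 / 2 * v := by
        nlinarith [mul_nonneg (mul_nonneg (by linarith : 0 ≤ n) hδ₀) (by linarith : 0 ≤ n - 2)]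
      have h₃ : 0 ≤ (1 - 2 * v) * (n - 2 * v) - δ * (2 * n - 6 * n * v + 4 * v ^ 2) := by
        have h₄ : δ * (2 * n - 6 * n * v + 4 * v ^ 2) =
            n * δ * (2 - 6 * v) + δ * (4 * v ^ 2) := by ring
        have h₅ : δ ≤ 5 / 4 * v := by nlinarith
        have h₆ : δ * (4 * v ^ 2) ≤ 5 / 4 * v * (4 * v ^ 2) := by gcongr
        have h₇ : (1 - 2 * v) * (2 - 2 * v) ≤ (1 - 2 * v) * (n - 2 * v) := by
          gcongr
          linarith
        rw [h₄]
        rcases le_total v (1 / 3) with hv3 | hv3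
        · have h₈ : n * δ * (2 - 6 * v) ≤ 5 / 2 * v * (2 - 6 * v) := by
            gcongr
            linarith
          nlinarith [sq_nonneg (v - 3 / 10), mul_nonneg hv (sq_nonneg (v - 3 / 10))]
        · have hv3' : 0 ≤ 6 * v - 2 := by linarith
          have h₈ : 0 ≤ (1 - 2 * v) * (2 - 2 * v) := mul_nonneg (by linarith) (by linarith)
          linarith [mul_nonneg hd h₈, mul_nonneg hδ₀ hv3',
            mul_nonneg (mul_nonneg hδ₀ (sub_nonneg.2 hn)) hv3']
      rw [e']
      positivity
  nlinarith [nonneg_of_mul_nonneg_left this hp]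

/-- A lower bound for the growth of a solution of the normalised recurrence. -/
lemma recurrence_growth_bound {Q : ℕ → ℝ} {δ : ℝ} (hδ₀ : 0 ≤ δ) (hδ : δ ≤ 1) (h0 : Q 0 = 1)
    (h1 : Q 1 = 1)
    (hQ : ∀ n : ℕ, ((n : ℝ) + 2) * Q (n + 2) =
      (2 * n + 3) * Q (n + 1) - (n + 1) * (1 - δ) * Q n) (n : ℕ) :
    0 < Q (n + 1) ∧ ∃ v : ℝ, 0 ≤ v ∧ v ≤ n + 1 ∧
      ((n : ℝ) + 2) * Q (n + 2) = (n + 2 + v) * Q (n + 1) ∧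
      ((n : ℝ) + 2) * (n + 1) * δ ≤ v ^ 2 + 2 * v ∧
      4 * (((n : ℝ) + 2) * (n + 1) * δ) ≤ 4 * v ^ 2 + 6 * v + 1 := by
  induction n with
  | zero =>
    have := hQ 0
    norm_num [h0, h1] at this ⊢
    refine ⟨δ, hδ₀, hδ, by linarith, by nlinarith, by nlinarith [sq_nonneg (4 * δ - 1)]⟩
  | succ n ih =>
    obtain ⟨hpos, v, hv, hvn, hv', hA, hB⟩ := ih
    have hn : (0 : ℝ) ≤ n := n.cast_nonneg
    have hs : 0 < (n : ℝ) + 2 + v := by positivity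
    have hpos' : 0 < Q (n + 2) := by
      refine pos_of_mul_pos_right (?_ : 0 < ((n : ℝ) + 2) * Q (n + 2)) (by positivity)
      rw [hv']
      positivity
    set w : ℝ := (n + 2) * (v + (n + 2) * δ) / (n + 2 + v) with hw_def
    have hw : w * (n + 2 + v) = (n + 2) * (v + (n + 2) * δ) := div_mul_cancel₀ _ hs.ne'
    have hn2 : (2 : ℝ) ≤ n + 2 := by linarith
    have hA' := riccati_lower_bound_step (n := n + 2) (by linarith) hδ hv hw
      (by rw [show (n : ℝ) + 2 - 1 = n + 1 by ring]; exact hA)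
    have hB' := riccati_upper_range_step (n := n + 2) hn2 hδ₀ hδ hv (by linarith) hw
      (by rw [show (n : ℝ) + 2 - 1 = n + 1 by ring]; exact hA)
      (by rw [show (n : ℝ) + 2 - 1 = n + 1 by ring]; exact hB)
    refine ⟨hpos', w, by positivity, ?_, ?_, ?_, ?_⟩
    · rw [hw_def, div_le_iff₀ hs]
      push_cast
      nlinarith [mul_nonneg (mul_nonneg (by linarith : (0 : ℝ) ≤ n + 2)
        (by linarith : (0 : ℝ) ≤ n + 2)) (sub_nonneg.2 hδ)]
    · have h := hQ (n + 1)
      push_cast at h ⊢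
      refine mul_right_cancel₀ hs.ne' ?_
      linear_combination (n + 2 + v) * h - Q (n + 2) * hw + (n + 2) * (1 - δ) * hv'
    · push_cast
      linarith
    · push_cast
      linarith

/-- Positivity, as a function of the growth rate `v`, of the quadratic form expressing strict
log-concavity. -/
lemma log_concavity_form_pos {n δ v : ℝ} (hn : 4 ≤ n)
    (hB : 4 * (n * (n - 1) * δ) ≤ 4 * v ^ 2 + 6 * v + 1)
    (hE : (n + v) ^ 2 * (n ^ 3 - 2 * n - 1) ≤ (1 - δ) * (n ^ 4 * (n + 2))) :
    0 < (n + 1) ^ 3 * v ^ 2 + n * (n ^ 2 + 4 * n + 2) * v + n ^ 2 * (n + 1) -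
      n ^ 4 * (n + 2) * δ := by
  by_contra! hT
  have hE' : n * (2 * n + 1) * ((n + 1) * v ^ 2 - n ^ 2 * (1 - v)) ≤ 0 := by linarith
  have hE'' : (n + 1) * v ^ 2 - n ^ 2 * (1 - v) ≤ 0 :=
    nonpos_of_mul_nonpos_right hE' (by positivity)
  have hB₁ := mul_le_mul_of_nonneg_left hB (by positivity : 0 ≤ n ^ 3 * (n + 2))
  have hB₂ : 0 ≤ 4 * (n - 1) * -((n + 1) ^ 3 * v ^ 2 + n * (n ^ 2 + 4 * n + 2) * v +
      n ^ 2 * (n + 1) - n ^ 4 * (n + 2) * δ) :=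
    mul_nonneg (by linarith) (by linarith)
  have hB₃ : 3 * n ^ 4 - 2 * n ^ 3 - 4 * n ^ 2 - (2 * n ^ 4 + 8 * n ^ 2 + 8 * n) * v -
      4 * (2 * n + 1) * v ^ 2 ≤ 0 := by linarith
  have hC := mul_nonneg (by positivity : 0 ≤ 2 * n ^ 2 + 1) (neg_nonneg.2 hE'')
  have hquad : (2 * n ^ 3 + 2 * n ^ 2 - 7 * n - 3) * v ^ 2 - n * (7 * n + 8) * v +
      n ^ 2 * (n ^ 2 - 2 * n - 5) ≤ 0 := by linarith
  obtain ⟨m, rfl⟩ : ∃ m, n = m + 4 := ⟨n - 4, by ring⟩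
  have hm : 0 ≤ m := by linarith
  set a := 2 * (m + 4) ^ 3 + 2 * (m + 4) ^ 2 - 7 * (m + 4) - 3 with ha
  have ha' : 0 < a := by
    have : a = 2 * m ^ 3 + 26 * m ^ 2 + 105 * m + 129 := by rw [ha]; ring
    rw [this]; positivity
  have hdisc : 0 < (m + 4) ^ 2 * (4 * a * ((m + 4) ^ 2 - 2 * (m + 4) - 5) -
      (7 * (m + 4) + 8) ^ 2) := by
    have : 4 * a * ((m + 4) ^ 2 - 2 * (m + 4) - 5) - (7 * (m + 4) + 8) ^ 2 =
        8 * m ^ 5 + 152 * m ^ 4 + 1068 * m ^ 3 + 3299 * m ^ 2 + 3852 * m + 252 := by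
      rw [ha]; ring
    rw [this]; positivity
  have h₁ := mul_nonpos_of_nonneg_of_nonpos ha'.le hquad
  linarith [sq_nonneg (2 * a * v - (m + 4) * (7 * (m + 4) + 8))]

/-- The inductive step for strict log-concavity, where `e, a, b, c` are consecutive terms. -/
lemma log_concavity_step {N δ v e a b c : ℝ} (hN : 4 ≤ N) (hδ : δ ≤ 1) (ha : 0 < a)
    (hab : N * b = (N + v) * a) (hB : 4 * (N * (N - 1) * δ) ≤ 4 * v ^ 2 + 6 * v + 1)
    (hr₁ : N * b = (2 * N - 1) * a - (N - 1) * (1 - δ) * e)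
    (hr₂ : (N + 1) * c = (2 * N + 1) * b - N * (1 - δ) * a)
    (ih : 0 < N ^ 2 * a ^ 2 - (N - 1) * (N + 1) * (e * b)) :
    0 < (N + 1) ^ 2 * b ^ 2 - N * (N + 2) * (a * c) := by
  have hd : 0 ≤ 1 - δ := by linarith
  have hN1 : 0 < 2 * N - 1 := by linarith
  rcases lt_or_ge 0 ((N + 1) * (N ^ 2 - N - 1) * b ^ 2 - N ^ 2 * (N + 2) * (1 - δ) * a ^ 2)
    with hE | hE
  · refine pos_of_mul_pos_right (a := (2 * N - 1) * (N + 1) ^ 2) ?_ (by positivity)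
    have key : (2 * N - 1) * (N + 1) ^ 2 * ((N + 1) ^ 2 * b ^ 2 - N * (N + 2) * (a * c)) =
        N * (N + 2) * (2 * N + 1) * (1 - δ) * (N ^ 2 * a ^ 2 - (N - 1) * (N + 1) * (e * b)) +
        ((N + 1) * (N ^ 2 - N - 1) * b ^ 2 - N ^ 2 * (N + 2) * (1 - δ) * a ^ 2) := by
      linear_combination -(N * (N + 2) * (2 * N - 1) * (N + 1)) * a * hr₂ +
        N * (N + 2) * (2 * N + 1) * (N + 1) * b * hr₁
    rw [key]
    exact add_pos_of_nonneg_of_pos (by positivity) hE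
  · have hE' : a ^ 2 * ((N + v) ^ 2 * (N ^ 3 - 2 * N - 1) - (1 - δ) * (N ^ 4 * (N + 2))) ≤ 0 := by
      have : a ^ 2 * ((N + v) ^ 2 * (N ^ 3 - 2 * N - 1) - (1 - δ) * (N ^ 4 * (N + 2))) =
          N ^ 2 * ((N + 1) * (N ^ 2 - N - 1) * b ^ 2 -
            N ^ 2 * (N + 2) * (1 - δ) * a ^ 2) := by
        linear_combination -(N ^ 3 - 2 * N - 1) * (N * b + (N + v) * a) * hab
      rw [this]
      exact mul_nonpos_of_nonneg_of_nonpos (by positivity) hE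
    have hT := log_concavity_form_pos hN hB
      (sub_nonpos.1 (nonpos_of_mul_nonpos_right hE' (by positivity)))
    refine pos_of_mul_pos_right (a := (N + 1) * N ^ 2) ?_ (by positivity)
    have key : (N + 1) * N ^ 2 * ((N + 1) ^ 2 * b ^ 2 - N * (N + 2) * (a * c)) =
        a ^ 2 * ((N + 1) ^ 3 * v ^ 2 + N * (N ^ 2 + 4 * N + 2) * v + N ^ 2 * (N + 1) -
          N ^ 4 * (N + 2) * δ) := by
      linear_combination -(N ^ 3 * (N + 2)) * a * hr₂ +
        ((N + 1) ^ 3 * (N * b + (N + v) * a) - N ^ 2 * (N + 2) * (2 * N + 1) * a) * hab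
    rw [key]
    positivity

/-- Strict log-concavity of `(n + 1) Q n` for a solution `Q` of the normalised recurrence. -/
lemma recurrence_log_concave {Q : ℕ → ℝ} {δ : ℝ} (hδ₀ : 0 ≤ δ) (hδ : δ ≤ 1) (h0 : Q 0 = 1)
    (h1 : Q 1 = 1)
    (hQ : ∀ n : ℕ, ((n : ℝ) + 2) * Q (n + 2) =
      (2 * n + 3) * Q (n + 1) - (n + 1) * (1 - δ) * Q n) :
    0 ≤ (2 + 1) ^ 2 * Q 2 ^ 2 - 2 * (2 + 2) * (Q 1 * Q 3) ∧ ∀ n : ℕ,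
      0 < ((n : ℝ) + 4) ^ 2 * Q (n + 3) ^ 2 - (n + 3) * (n + 5) * (Q (n + 2) * Q (n + 4)) := by
  have q2 : Q 2 = 1 + δ / 2 := by
    have := hQ 0
    norm_num [h0, h1] at this
    linarith
  have q3 : Q 3 = 1 + 3 * δ / 2 := by
    have := hQ 1
    norm_num [h1, q2] at this
    linarith
  have q4 : Q 4 = 1 + 3 * δ + 3 * δ ^ 2 / 8 := by
    have := hQ 2
    norm_num [q2, q3] at this
    linarith
  refine ⟨?_, fun n => ?_⟩
  · rw [h1, q2, q3]
    nlinarith [sq_nonneg (3 * δ - 2)]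
  · induction n with
    | zero =>
      norm_num [q2, q3, q4]
      nlinarith [sq_nonneg (δ - 1 / 3), sq_nonneg δ, mul_nonneg (sub_nonneg.2 hδ) (sq_nonneg δ)]
    | succ n ih =>
      have hn : (0 : ℝ) ≤ n := n.cast_nonneg
      obtain ⟨hpos, v, -, -, hv', -, hB⟩ := recurrence_growth_bound hδ₀ hδ h0 h1 hQ (n + 2)
      have hr₁ := hQ (n + 2)
      have hr₂ := hQ (n + 3)
      have := log_concavity_step (N := n + 4) (v := v) (e := Q (n + 2)) (a := Q (n + 3))
        (b := Q (n + 4)) (c := Q (n + 5)) (by linarith) hδ hpos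
        (by push_cast at hv'; linear_combination hv')
        (by push_cast at hB; linear_combination hB)
        (by push_cast at hr₁; linear_combination hr₁)
        (by push_cast at hr₂; linear_combination hr₂) (by linarith)
      push_cast
      linarith

/-- For fixed reals `y, z ≥ 0` not both zero, the sequence
`S_n(y,z) = (n+1) ∑_{k=0}^n C(n,k)² y^k z^{n−k}` is log-concave in `n` for `n ≥ 1` and
strictly log-concave for `n ≥ 2`. -/
theorem binomial_square_sum_log_concave
    (y z : ℝ) (hy : 0 ≤ y) (hz : 0 ≤ z) (hyz : ¬(y = 0 ∧ z = 0))
    (S : ℕ → ℝ)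
    (hS : ∀ n : ℕ, S n =
      ((n : ℝ) + 1) * ∑ k ∈ Finset.range (n + 1), (n.choose k : ℝ) ^ 2 * y ^ k * z ^ (n - k)) :
    (∀ n : ℕ, 2 ≤ n → S (n - 1) * S (n + 1) ≤ S n ^ 2) ∧
    (∀ n : ℕ, 3 ≤ n → S (n - 1) * S (n + 1) < S n ^ 2) := by
  have ha : 0 < y + z := by
    rcases hy.lt_or_eq with h | h
    · linarith
    · rcases hz.lt_or_eq with h' | h'
      · linarith
      · exact absurd ⟨h.symm, h'.symm⟩ hyz
  set H : ℕ → ℝ := fun n => homogeneousSum y z n fun k => (n.choose k : ℝ) ^ 2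
  set Q : ℕ → ℝ := fun n => H n / (y + z) ^ n
  set δ : ℝ := 4 * y * z / (y + z) ^ 2 with hδ_def
  have hHQ (n : ℕ) : H n = Q n * (y + z) ^ n := (div_mul_cancel₀ _ (by positivity)).symm
  have hδa : δ * (y + z) ^ 2 = 4 * y * z := div_mul_cancel₀ _ (by positivity)
  have hδ₀ : 0 ≤ δ := by positivity
  have hδ : δ ≤ 1 := by
    rw [hδ_def, div_le_one (by positivity)]
    nlinarith [sq_nonneg (y - z)]
  have h0 : Q 0 = 1 := by simp [Q, H, homogeneousSum]
  have h1 : Q 1 = 1 := by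
    have : H 1 = y + z := by simp [H, homogeneousSum, Finset.sum_range_succ, add_comm]
    simp only [Q, this, pow_one, div_self ha.ne']
  have hQ (n : ℕ) : ((n : ℝ) + 2) * Q (n + 2) =
      (2 * n + 3) * Q (n + 1) - (n + 1) * (1 - δ) * Q n := by
    have h : ((n : ℝ) + 2) * H (n + 2) =
        (2 * n + 3) * (y + z) * H (n + 1) - (n + 1) * (y - z) ^ 2 * H n :=
      homogeneousSum_choose_sq_recurrence y z n
    simp only [hHQ] at h
    refine mul_right_cancel₀ (pow_pos ha (n + 2)).ne' ?_
    linear_combination h - (n + 1) * Q n * (y + z) ^ n * hδa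
  obtain ⟨hweak, hstrict⟩ := recurrence_log_concave hδ₀ hδ h0 h1 hQ
  have hSQ (n : ℕ) : S n = (n + 1) * (Q n * (y + z) ^ n) := by
    rw [hS, ← hHQ]
    rfl
  have strict (n : ℕ) (hn : 3 ≤ n) : S (n - 1) * S (n + 1) < S n ^ 2 := by
    obtain ⟨m, rfl⟩ := Nat.exists_eq_add_of_le' hn
    have h := mul_pos (pow_pos ha (2 * (m + 3))) (hstrict m)
    simp only [hSQ, show m + 3 - 1 = m + 2 from rfl]
    push_cast
    rw [← sub_pos]
    refine h.trans_eq ?_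
    ring
  refine ⟨fun n hn => ?_, strict⟩
  rcases hn.eq_or_lt with rfl | hn
  · have h := mul_nonneg (pow_pos ha 4).le hweak
    simp only [hSQ]
    rw [← sub_nonneg]
    norm_num at h ⊢
    linarith
  · exact (strict n hn).le
end

section
/- Let θ ∈ ℝ and σ > 0, and for integers n ≥ 1 define g(n) := (n+σ²)/(σ√(2π(2n+σ²))) · exp(−θ²σ²/(4n+2σ²)) (this is the expected posterior ψ_{θ,θ}(n) = E_θ[q_n^θ] for iid N(θ,σ²) observations with standard normal prior). If σ² ≤ √2 or |θ| ≥ 1/2, then the sequence g(n) is strictly log-concave for n ≥ 1: g(n−1) · g(n+1) < g(n)² for every integer n ≥ 2. -/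
/-- The rational inequality behind strict log-concavity, with `s = σ²` and `q = θ²`. -/
lemma rational_log_concave {n s q : ℝ} (hn : 2 ≤ n) (hs : 0 < s) (hq : 0 ≤ q)
    (h : s ^ 2 ≤ 2 ∨ 1 / 4 ≤ q) :
    ((n + s) ^ 2 - 1) ^ 2 * (2 * n + s) ^ 3 <
      (n + s) ^ 4 * ((2 * n + s) * ((2 * n + s) ^ 2 - 4) + 8 * q * s) := by
  obtain ⟨m, rfl⟩ : ∃ m, s = m - n := ⟨n + s, by ring⟩
  have hm : 0 < m := by linarith
  have hnm : n < m := by linarith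
  have ht : 0 < m + n := by linarith
  have e1 : n + (m - n) = m := by ring
  have e2 : 2 * n + (m - n) = m + n := by ring
  rw [e1, e2]
  rcases h with h | h
  · have key : 0 < 2 * m ^ 2 * (2 * n ^ 2 - (m - n) ^ 2) - (m + n) ^ 2 := by
      have h1 : 6 ≤ 2 * n ^ 2 - (m - n) ^ 2 := by nlinarith
      have h2 : 2 * m ^ 2 * 6 ≤ 2 * m ^ 2 * (2 * n ^ 2 - (m - n) ^ 2) :=
        mul_le_mul_of_nonneg_left h1 (by positivity)
      nlinarith
    have h3 := mul_pos ht key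
    have h4 : 0 ≤ m ^ 4 * (8 * q * (m - n)) := by positivity
    linear_combination h3 + h4
  · have key : 0 < 6 * m ^ 3 * n ^ 2 + 2 * m ^ 2 * n ^ 3 - (m + n) ^ 3 := by
      have h1 : (m + n) ^ 3 ≤ (2 * m) ^ 3 := by gcongr; linarith
      have h2 : 6 * m ^ 3 * 2 ^ 2 ≤ 6 * m ^ 3 * n ^ 2 := by gcongr
      have h3 : 0 < 2 * m ^ 2 * n ^ 3 := by positivity
      have h4 : 0 < m ^ 3 := by positivity
      linarith
    have h4 : 0 ≤ m ^ 4 * (8 * (q - 1 / 4) * (m - n)) :=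
      mul_nonneg (by positivity) (mul_nonneg (by linarith) hs.le)
    linear_combination key + h4

/-- Strict log-concavity of `(n+s)²/(2n+s) · exp(-qs/(2n+s))`. -/
lemma exp_log_concave {n s q : ℝ} (hn : 2 ≤ n) (hs : 0 < s) (hq : 0 ≤ q)
    (h : s ^ 2 ≤ 2 ∨ 1 / 4 ≤ q) :
    ((n - 1 + s) ^ 2 / (2 * (n - 1) + s) * Real.exp (-(q * s) / (2 * (n - 1) + s))) *
      ((n + 1 + s) ^ 2 / (2 * (n + 1) + s) * Real.exp (-(q * s) / (2 * (n + 1) + s))) <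
      ((n + s) ^ 2 / (2 * n + s) * Real.exp (-(q * s) / (2 * n + s))) ^ 2 := by
  have key := rational_log_concave hn hs hq h
  have ht : 0 < 2 * n + s := by linarith
  have ht1 : 0 < 2 * (n - 1) + s := by linarith
  have ht2 : 0 < 2 * (n + 1) + s := by linarith
  have hx : 0 ≤ 8 * q * s / ((2 * n + s) * ((2 * (n - 1) + s) * (2 * (n + 1) + s))) := by
    positivity
  set x := 8 * q * s / ((2 * n + s) * ((2 * (n - 1) + s) * (2 * (n + 1) + s))) with hxdef
  set A := Real.exp (-(q * s) / (2 * (n - 1) + s)) * Real.exp (-(q * s) / (2 * (n + 1) + s))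
    with hA
  have hApos : 0 < A := by positivity
  have hexp : Real.exp (-(q * s) / (2 * n + s)) ^ 2 = A * Real.exp x := by
    rw [hA, sq, ← Real.exp_add, ← Real.exp_add, ← Real.exp_add, hxdef]
    congr 1
    field_simp
    ring
  have hrat : (n - 1 + s) ^ 2 / (2 * (n - 1) + s) * ((n + 1 + s) ^ 2 / (2 * (n + 1) + s)) <
      ((n + s) ^ 2 / (2 * n + s)) ^ 2 * (1 + x) := by
    have e : ((n + s) ^ 2 / (2 * n + s)) ^ 2 * (1 + x) =
        (n + s) ^ 4 * ((2 * n + s) * ((2 * n + s) ^ 2 - 4) + 8 * q * s) /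
          ((2 * n + s) ^ 3 * ((2 * (n - 1) + s) * (2 * (n + 1) + s))) := by
      rw [hxdef]
      field_simp
      ring
    rw [e, div_mul_div_comm, div_lt_div_iff₀ (by positivity) (by positivity)]
    have := mul_lt_mul_of_pos_right key (mul_pos ht1 ht2)
    linear_combination this
  calc _ = (n - 1 + s) ^ 2 / (2 * (n - 1) + s) * ((n + 1 + s) ^ 2 / (2 * (n + 1) + s)) * A := by
        rw [hA]; ring
    _ < ((n + s) ^ 2 / (2 * n + s)) ^ 2 * (1 + x) * A := mul_lt_mul_of_pos_right hrat hApos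
    _ ≤ ((n + s) ^ 2 / (2 * n + s)) ^ 2 * Real.exp x * A := by
        gcongr
        linarith [Real.add_one_le_exp x]
    _ = _ := by rw [mul_pow, hexp]; ring


/-- Let `θ ∈ ℝ`, `σ > 0`, and for integers `n ≥ 1` let
`g(n) = (n+σ²)/(σ√(2π(2n+σ²))) · exp(−θ²σ²/(4n+2σ²))` (the expected posterior
`ψ_{θ,θ}(n)` for iid `N(θ,σ²)` observations with standard normal prior).  If `σ² ≤ √2` or
`|θ| ≥ 1/2`, then `g` is strictly log-concave for `n ≥ 1`. -/
theorem normal_expected_posterior_log_concave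
    (θ σ : ℝ) (hσ : 0 < σ)
    (g : ℕ → ℝ)
    (hg : ∀ n : ℕ, g n =
      ((n : ℝ) + σ ^ 2) / (σ * Real.sqrt (2 * Real.pi * (2 * (n : ℝ) + σ ^ 2))) *
        Real.exp (-(θ ^ 2 * σ ^ 2) / (4 * (n : ℝ) + 2 * σ ^ 2)))
    (hcond : σ ^ 2 ≤ Real.sqrt 2 ∨ 1 / 2 ≤ |θ|) :
    ∀ n : ℕ, 2 ≤ n → g (n - 1) * g (n + 1) < g n ^ 2 := by
  intro n hn
  have hs : 0 < σ ^ 2 := by positivity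
  have hn' : (2 : ℝ) ≤ n := by exact_mod_cast hn
  have hc : (σ ^ 2) ^ 2 ≤ 2 ∨ 1 / 4 ≤ θ ^ 2 := by
    rcases hcond with h | h
    · left
      calc (σ ^ 2) ^ 2 ≤ Real.sqrt 2 ^ 2 := by gcongr
        _ = 2 := Real.sq_sqrt (by norm_num)
    · right
      rw [← sq_abs]
      nlinarith
  have hsq : ∀ k : ℕ, g k ^ 2 = (σ ^ 2 * (2 * Real.pi))⁻¹ *
      (((k : ℝ) + σ ^ 2) ^ 2 / (2 * k + σ ^ 2) *
        Real.exp (-(θ ^ 2 * σ ^ 2) / (2 * k + σ ^ 2))) := by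
    intro k
    have ht : 0 < 2 * (k : ℝ) + σ ^ 2 := by positivity
    have he : Real.exp (-(θ ^ 2 * σ ^ 2) / (4 * (k : ℝ) + 2 * σ ^ 2)) ^ 2 =
        Real.exp (-(θ ^ 2 * σ ^ 2) / (2 * k + σ ^ 2)) := by
      rw [sq, ← Real.exp_add]
      congr 1
      rw [show 4 * (k : ℝ) + 2 * σ ^ 2 = 2 * (2 * k + σ ^ 2) by ring]
      field_simp
      ring
    rw [hg, mul_pow, he, div_pow, mul_pow, Real.sq_sqrt (by positivity)]
    field_simp
  have hcast : ((n - 1 : ℕ) : ℝ) = n - 1 := by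
    rw [Nat.cast_sub (by omega), Nat.cast_one]
  have key := exp_log_concave hn' hs (sq_nonneg θ) hc
  refine lt_of_pow_lt_pow_left₀ 2 (by positivity) ?_
  have hC : 0 < ((σ ^ 2 * (2 * Real.pi))⁻¹) ^ 2 := by positivity
  rw [mul_pow, hsq, hsq, hsq, hcast, Nat.cast_add, Nat.cast_one]
  have := mul_lt_mul_of_pos_left key hC
  linear_combination this
end

section
/- Let θ > 0 and for integers n ≥ 1 define ψ(n) := e^{−θ} θ^{2n} / ((n−1)!·n!) · ∫₀^∞ u^{n−1} (u+1)^{n+1} e^{−2θu} du (this is the expected posterior ψ_{θ,θ}(n) = E_θ[q_n^θ] for iid Exp(θ) observations with an Exp(1) prior on θ). Then the sequence ψ(n) is strictly log-concave for n ≥ 1: ψ(n−1) · ψ(n+1) < ψ(n)² for every integer n ≥ 2. -/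
open MeasureTheory

/-- The reverse Bessel polynomials `1, 1 + θ, 3 + 3θ + θ², …`, evaluated at `θ`. -/
noncomputable def reverseBessel (θ : ℝ) : ℕ → ℝ
  | 0 => 1
  | 1 => 1 + θ
  | n + 2 => (2 * n + 3) * reverseBessel θ (n + 1) + θ ^ 2 * reverseBessel θ n

theorem reverseBessel_pos {θ : ℝ} (hθ : 0 < θ) : ∀ n, 0 < reverseBessel θ n
  | 0 => by simp [reverseBessel]
  | 1 => by simp only [reverseBessel]; positivity
  | n + 2 => by
    have h₁ := reverseBessel_pos hθ (n + 1)
    have h₀ := reverseBessel_pos hθ n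
    simp only [reverseBessel]
    positivity

/-- Consecutive ratios of the reverse Bessel polynomials increase, by steps of at most `2`. -/
theorem reverseBessel_ratio_diff_mem {θ : ℝ} (hθ : 0 < θ) (n : ℕ) :
    reverseBessel θ (n + 2) / reverseBessel θ (n + 1) -
      reverseBessel θ (n + 1) / reverseBessel θ n ∈ Set.Icc (0 : ℝ) 2 := by
  induction n with
  | zero =>
    have h : reverseBessel θ 2 / reverseBessel θ 1 - reverseBessel θ 1 / reverseBessel θ 0 =
        2 - θ / (1 + θ) := by
      simp only [reverseBessel]
      have : 1 + θ ≠ 0 := by positivity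
      field_simp
      push_cast
      ring
    have h₁ : θ / (1 + θ) ≤ 1 := by rw [div_le_one (by positivity)]; linarith
    have h₀ : 0 ≤ θ / (1 + θ) := by positivity
    rw [zero_add, zero_add, h]
    constructor <;> linarith
  | succ n ih =>
    have h₀ := reverseBessel_pos hθ n
    have h₁ := reverseBessel_pos hθ (n + 1)
    have h₂ := reverseBessel_pos hθ (n + 2)
    set d := reverseBessel θ (n + 2) / reverseBessel θ (n + 1) -
      reverseBessel θ (n + 1) / reverseBessel θ n with hd
    set ρ := θ ^ 2 * reverseBessel θ n / reverseBessel θ (n + 2) with hρ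
    have hρ₀ : 0 ≤ ρ := by positivity
    have hρ₁ : ρ ≤ 1 := by
      rw [hρ, div_le_one h₂, reverseBessel]
      have : 0 ≤ (2 * (n : ℝ) + 3) * reverseBessel θ (n + 1) := by positivity
      linarith
    have h : reverseBessel θ (n + 1 + 2) / reverseBessel θ (n + 1 + 1) -
        reverseBessel θ (n + 1 + 1) / reverseBessel θ (n + 1) = 2 - d * ρ := by
      have e₃ : reverseBessel θ (n + 1 + 2) = (2 * (n + 1 : ℕ) + 3) * reverseBessel θ (n + 2) +
        θ ^ 2 * reverseBessel θ (n + 1) := by rw [reverseBessel]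
      have e₂ : θ ^ 2 * reverseBessel θ n =
          reverseBessel θ (n + 2) - (2 * n + 3) * reverseBessel θ (n + 1) := by
        rw [reverseBessel]; ring
      have e : d * ρ = θ ^ 2 * reverseBessel θ n / reverseBessel θ (n + 1) -
          θ ^ 2 * reverseBessel θ (n + 1) / reverseBessel θ (n + 2) := by
        rw [hd, hρ]; field_simp
      rw [e, e₃, e₂]
      field_simp
      push_cast
      ring
    rw [h]
    obtain ⟨hd₀, hd₂⟩ := ih
    constructor <;> nlinarith [mul_nonneg hd₀ hρ₀, mul_nonneg hd₀ (sub_nonneg.2 hρ₁)]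

theorem turan_quadratic_pos {p a d t : ℝ} (hp : 0 ≤ p) (ha : 0 < a) (hd₂ : d ≤ 2)
    (ht : 0 < t) (hT : t ^ 2 = a * (a + 2 * p + 3 - d)) :
    (p + 2) * (a + 2 * p + 3 + t - (p + 2)) *
      ((p + 3 + t) * ((2 * p + 5) * (a + 2 * p + 3) + t ^ 2) + t ^ 2 * (a + 2 * p + 3)) <
    (p + 3) * ((p + 2 + t) * (a + 2 * p + 3) + t ^ 2) ^ 2 := by
  obtain ⟨δ, rfl⟩ : ∃ δ, d = 2 - δ := ⟨2 - d, by ring⟩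
  have hδ₀ : 0 ≤ δ := by linarith
  obtain ⟨T, hTdef⟩ : ∃ T, T = a * (a + 2 * p + 3 - (2 - δ)) := ⟨_, rfl⟩
  rw [← hTdef] at hT
  obtain ⟨E, hE⟩ : ∃ E, E = (2 * p + 3) * T * (a + 2 * p + 3) + (p + 2) * (p + 3) * (a + 2 * p + 3)
    + (2 - δ) * a * T - (2 - δ) * a * (p + 2) * (p + 3) ^ 2 + 2 * T ^ 2
    - (p + 2) * (p + 3) * T := ⟨_, rfl⟩
  obtain ⟨Q, hQ⟩ : ∃ Q, Q =
    2 * T * (a + 2 * p + 3) - 2 * (p + 2) * (a + 2 * p + 3) + (2 - δ) * a * (p + 2) := ⟨_, rfl⟩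
  have key : (p + 3) * ((p + 2 + t) * (a + 2 * p + 3) + t ^ 2) ^ 2 -
      (p + 2) * (a + 2 * p + 3 + t - (p + 2)) *
      ((p + 3 + t) * ((2 * p + 5) * (a + 2 * p + 3) + t ^ 2) + t ^ 2 * (a + 2 * p + 3)) =
      E + t * Q := by
    rw [hE, hQ]
    subst hT
    linear_combination -((p + 2) * t + t ^ 2 - (p + 2) * (p + 3) ^ 2) * hTdef
  suffices 0 < E + t * Q by linarith
  rcases le_or_gt 0 Q with hQ₀ | hQ₀
  · have : 0 < E := by
      have h₀ : 0 < 18 - 27 * a + 10 * a ^ 2 + 9 * a ^ 3 := by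
        nlinarith [sq_nonneg (a - 4 / 5), mul_nonneg ha.le (sq_nonneg (a - 4 / 5))]
      have h₁ : 0 < 27 - 24 * a + 27 * a ^ 2 := by linarith [sq_nonneg (a - 4 / 9)]
      have h₂ : E = (18 - 27 * a + 10 * a ^ 2 + 9 * a ^ 3) + p * (27 - 24 * a + 27 * a ^ 2)
          + (13 * p ^ 2 + 2 * p ^ 3 + 2 * a * p ^ 2 + 4 * a * p ^ 3 + 15 * a ^ 2 * p ^ 2
            + 10 * a ^ 3 * p + 2 * a ^ 4)
          + δ * (21 * a + 28 * a * p + 11 * a * p ^ 2 + a * p ^ 3 + 8 * a ^ 2 + 8 * a ^ 2 * p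
            + 3 * a ^ 3) + δ ^ 2 * a ^ 2 := by
        rw [hE, hTdef]
        ring
      rw [h₂]
      positivity
    positivity
  · have h₁ : 2 * t ≤ T + 1 := by nlinarith [sq_nonneg (t - 1)]
    have : 0 < 2 * E + (T + 1) * Q := by
      have h₀ : 0 < 24 - 60 * a + 22 * a ^ 2 + 34 * a ^ 3 + 14 * a ^ 4 := by
        linarith [sq_nonneg (a ^ 2 - 1 / 4), sq_nonneg (a - 137 / 252),
          mul_nonneg ha.le (sq_nonneg (a - 1 / 2))]
      have h₁ : 0 < 40 - 70 * a + 76 * a ^ 2 := by linarith [sq_nonneg (a - 35 / 76)]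
      have h₂ : 0 < 22 - 20 * a + 66 * a ^ 2 := by linarith [sq_nonneg (a - 5 / 33)]
      have h₃ : 2 * E + (T + 1) * Q =
          (24 - 60 * a + 22 * a ^ 2 + 34 * a ^ 3 + 14 * a ^ 4) + p * (40 - 70 * a + 76 * a ^ 2)
          + p ^ 2 * (22 - 20 * a + 66 * a ^ 2)
          + (4 * p ^ 3 + 16 * a ^ 2 * p ^ 3 + 60 * a ^ 3 * p + 24 * a ^ 3 * p ^ 2
            + 12 * a ^ 4 * p + 2 * a ^ 5)
          + δ * (34 * a + 45 * a * p + 18 * a * p ^ 2 + 2 * a * p ^ 3 + 28 * a ^ 2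
            + 43 * a ^ 2 * p + 14 * a ^ 2 * p ^ 2 + 20 * a ^ 3 + 15 * a ^ 3 * p + 4 * a ^ 4)
          + δ ^ 2 * (6 * a ^ 2 + 3 * a ^ 2 * p + 2 * a ^ 3) := by
        rw [hE, hQ, hTdef]
        ring
      rw [h₃]
      positivity
    nlinarith [mul_nonneg_of_nonpos_of_nonpos (sub_nonpos.2 h₁) hQ₀.le]

theorem integrableOn_pow_mul_add_one_pow_mul_exp {c : ℝ} (hc : 0 < c) (i j : ℕ) :
    IntegrableOn (fun u : ℝ => u ^ i * (u + 1) ^ j * Real.exp (-c * u)) (Set.Ioi 0) := by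
  induction j generalizing i with
  | zero =>
    have h := integrableOn_rpow_mul_exp_neg_mul_rpow (s := i) (p := 1) (b := c)
      (by linarith [(Nat.cast_nonneg i : (0 : ℝ) ≤ i)]) zero_lt_one hc
    simpa using h
  | succ j ih =>
    refine ((ih (i + 1)).add (ih i)).congr_fun (fun u _ => ?_) measurableSet_Ioi
    simp only [Pi.add_apply]
    ring

/-- The integral of `u ^ i * (u + 1) ^ j` against `exp (-c * u)` over the positive half-line. -/
noncomputable def betaLaplace (c : ℝ) (i j : ℕ) : ℝ :=
  ∫ u in Set.Ioi (0 : ℝ), u ^ i * (u + 1) ^ j * Real.exp (-c * u)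

theorem betaLaplace_succ_right {c : ℝ} (hc : 0 < c) (i j : ℕ) :
    betaLaplace c i (j + 1) = betaLaplace c (i + 1) j + betaLaplace c i j := by
  simp only [betaLaplace]
  rw [← integral_add (integrableOn_pow_mul_add_one_pow_mul_exp hc (i + 1) j)
    (integrableOn_pow_mul_add_one_pow_mul_exp hc i j)]
  congr 1 with u
  ring

theorem betaLaplace_zero_right {c : ℝ} (hc : 0 < c) (i : ℕ) :
    betaLaplace c i 0 = i.factorial / c ^ (i + 1) := by
  have h := Real.integral_rpow_mul_exp_neg_mul_Ioi (a := (i : ℝ) + 1) (r := c) (by positivity) hc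
  rw [Real.Gamma_nat_eq_factorial] at h
  simp only [betaLaplace]
  have e : (1 / c : ℝ) ^ ((i : ℝ) + 1) = 1 / c ^ (i + 1) := by
    rw [← Nat.cast_succ, Real.rpow_natCast]; simp
  rw [e] at h
  rw [div_eq_mul_one_div, mul_comm, ← h]
  congr 1 with u
  simp

/-- Integration by parts. -/
theorem mul_betaLaplace_succ {c : ℝ} (hc : 0 < c) (i j : ℕ) :
    c * betaLaplace c (i + 1) j =
      (i + 1) * betaLaplace c i j + j * betaLaplace c (i + 1) (j - 1) := by
  induction j generalizing i with
  | zero =>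
    rw [betaLaplace_zero_right hc, betaLaplace_zero_right hc, Nat.factorial_succ]
    push_cast
    field_simp
    ring
  | succ j ih =>
    have h₁ := ih i
    have h₂ := ih (i + 1)
    have e := betaLaplace_succ_right hc
    rw [e (i + 1) j, e i j, mul_add, h₁, h₂]
    rcases j with _ | j
    · simp; ring
    · simp only [Nat.add_sub_cancel]
      rw [e (i + 1) j]
      push_cast
      ring

theorem betaLaplace_succ_self {c : ℝ} (hc : 0 < c) (k : ℕ) :
    c * betaLaplace c (k + 1) (k + 1) =
      (k + 1) * (2 * betaLaplace c (k + 1) k + betaLaplace c k k) := by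
  have h := mul_betaLaplace_succ hc k (k + 1)
  rw [betaLaplace_succ_right hc k k, Nat.add_sub_cancel] at h
  rw [h]
  push_cast
  ring

theorem betaLaplace_self_recurrence {c : ℝ} (hc : 0 < c) (k : ℕ) :
    c ^ 2 * betaLaplace c (k + 2) (k + 2) =
      2 * (k + 2) * (2 * k + 3) * betaLaplace c (k + 1) (k + 1) +
        (k + 2) * (k + 1) * betaLaplace c k k := by
  have h₂ := betaLaplace_succ_self hc (k + 1)
  have h₁ := betaLaplace_succ_self hc k
  have h := mul_betaLaplace_succ hc (k + 1) (k + 1)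
  have e := betaLaplace_succ_right hc (k + 1) k
  rw [Nat.add_sub_cancel] at h
  push_cast at h h₂ ⊢
  linear_combination c * h₂ + 2 * (k + 2) * h + (k + 2) * h₁ - 2 * (k + 2) * (k + 1) * e

theorem betaLaplace_self_eq {θ : ℝ} (hθ : 0 < θ) : ∀ n : ℕ, betaLaplace (2 * θ) n n =
    n.factorial * reverseBessel θ n / (2 * θ * (2 * θ ^ 2) ^ n)
  | 0 => by
    rw [betaLaplace_zero_right (by positivity)]
    simp [reverseBessel]
  | 1 => by
    rw [betaLaplace_succ_right (by positivity), betaLaplace_zero_right (by positivity),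
      betaLaplace_zero_right (by positivity)]
    simp only [reverseBessel, Nat.factorial]
    field_simp
    push_cast
    ring
  | n + 2 => by
    have h := betaLaplace_self_recurrence (c := 2 * θ) (by positivity) n
    rw [betaLaplace_self_eq hθ (n + 1), betaLaplace_self_eq hθ n] at h
    have h' : betaLaplace (2 * θ) (n + 2) (n + 2) = ((2 * θ) ^ 2)⁻¹ *
        ((2 * θ) ^ 2 * betaLaplace (2 * θ) (n + 2) (n + 2)) := by field_simp
    rw [h', h, reverseBessel, Nat.factorial_succ (n + 1), Nat.factorial_succ n]
    push_cast
    field_simp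
    ring

theorem betaLaplace_self_add_two {c : ℝ} (hc : 0 < c) (n : ℕ) :
    (n + 1) * betaLaplace c n (n + 2) =
      (n + 1 + c / 2) * betaLaplace c (n + 1) (n + 1) + (n + 1) / 2 * betaLaplace c n n := by
  have h := betaLaplace_succ_self hc n
  have e := betaLaplace_succ_right hc
  rw [e n (n + 1), e n n]
  linear_combination -h / 2

theorem expected_posterior_eq {θ : ℝ} (hθ : 0 < θ) (n : ℕ) :
    Real.exp (-θ) * θ ^ (2 * (n + 1)) / ((n.factorial : ℝ) * ((n + 1).factorial : ℝ)) *
        betaLaplace (2 * θ) n (n + 2) =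
      Real.exp (-θ) / (2 * θ * 2 ^ (n + 1) * (n + 1).factorial) *
        ((n + 1 + θ) * reverseBessel θ (n + 1) + θ ^ 2 * reverseBessel θ n) := by
  have h := betaLaplace_self_add_two (c := 2 * θ) (by positivity) n
  rw [betaLaplace_self_eq hθ, betaLaplace_self_eq hθ] at h
  have h' : betaLaplace (2 * θ) n (n + 2) = ((n : ℝ) + 1)⁻¹ *
      ((n + 1) * betaLaplace (2 * θ) n (n + 2)) := by field_simp
  rw [h', h, Nat.factorial_succ n]
  push_cast
  field_simp
  ring

theorem reverseBessel_turan {θ : ℝ} (hθ : 0 < θ) (m : ℕ) :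
    (m + 2) *
      ((m + 1 + θ) * reverseBessel θ (m + 1) + θ ^ 2 * reverseBessel θ m) *
      ((m + 3 + θ) * reverseBessel θ (m + 3) + θ ^ 2 * reverseBessel θ (m + 2)) <
    (m + 3) * ((m + 2 + θ) * reverseBessel θ (m + 2) + θ ^ 2 * reverseBessel θ (m + 1)) ^ 2 := by
  have h₀ := reverseBessel_pos hθ m
  have h₁ := reverseBessel_pos hθ (m + 1)
  have hd₂ := (reverseBessel_ratio_diff_mem hθ m).2
  set d := reverseBessel θ (m + 2) / reverseBessel θ (m + 1) -
    reverseBessel θ (m + 1) / reverseBessel θ m with hd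
  obtain ⟨a, ha⟩ : ∃ a, a = θ ^ 2 * reverseBessel θ m / reverseBessel θ (m + 1) := ⟨_, rfl⟩
  have ea : θ ^ 2 * reverseBessel θ m = a * reverseBessel θ (m + 1) := by rw [ha]; field_simp
  have e₂ : reverseBessel θ (m + 2) = (a + 2 * m + 3) * reverseBessel θ (m + 1) := by
    rw [reverseBessel, ea]; ring
  have e₃ : reverseBessel θ (m + 3) =
      ((2 * m + 5) * (a + 2 * m + 3) + θ ^ 2) * reverseBessel θ (m + 1) := by
    rw [reverseBessel, e₂]; push_cast; ring
  have hT : θ ^ 2 = a * (a + 2 * m + 3 - d) := by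
    rw [hd, e₂, mul_div_assoc, div_self h₁.ne', ha]
    field_simp
    ring
  have key := turan_quadratic_pos (p := m) (Nat.cast_nonneg m) (by rw [ha]; positivity)
    hd₂ hθ hT
  have := mul_lt_mul_of_pos_right key (pow_pos h₁ 2)
  rw [ea, e₂, e₃]
  exact lt_of_eq_of_lt (by ring) (this.trans_eq (by ring))

/-- Let `θ > 0` and for integers `n ≥ 1` let
`ψ(n) = e^{−θ} θ^{2n}/((n−1)!·n!) · ∫₀^∞ u^{n−1}(u+1)^{n+1} e^{−2θu} du` (the expected
posterior `ψ_{θ,θ}(n)` for iid `Exp(θ)` observations with an `Exp(1)` prior).  Then `ψ` is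
strictly log-concave for `n ≥ 1`. -/
theorem exponential_expected_posterior_log_concave
    (θ : ℝ) (hθ : 0 < θ)
    (ψ : ℕ → ℝ)
    (hψ : ∀ n : ℕ, ψ n =
      Real.exp (-θ) * θ ^ (2 * n) /
          ((Nat.factorial (n - 1) : ℝ) * (Nat.factorial n : ℝ)) *
        ∫ u in Set.Ioi (0 : ℝ), u ^ (n - 1) * (u + 1) ^ (n + 1) * Real.exp (-2 * θ * u)) :
    ∀ n : ℕ, 2 ≤ n → ψ (n - 1) * ψ (n + 1) < ψ n ^ 2 := by
  intro n hn
  obtain ⟨m, rfl⟩ := Nat.exists_eq_add_of_le' hn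
  have hψ' (k : ℕ) : ψ (k + 1) = Real.exp (-θ) / (2 * θ * 2 ^ (k + 1) * (k + 1).factorial) *
      ((k + 1 + θ) * reverseBessel θ (k + 1) + θ ^ 2 * reverseBessel θ k) := by
    rw [hψ, ← expected_posterior_eq hθ k, betaLaplace]
    simp only [Nat.add_sub_cancel, neg_mul]
  have e : m + 2 - 1 = m + 1 := rfl
  rw [e, hψ' m, hψ' (m + 1), hψ' (m + 2)]
  have h := mul_lt_mul_of_pos_left (reverseBessel_turan hθ m)
    (show 0 < (Real.exp (-θ) / (2 * θ * 2 ^ (m + 2) * (m + 2).factorial)) ^ 2 / (m + 3) by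
      positivity)
  have f₂ : ((m + 1 + 1).factorial : ℝ) = (m + 2) * (m + 1).factorial := by
    rw [Nat.factorial_succ]; push_cast; ring
  have f₃ : ((m + 2 + 1).factorial : ℝ) = (m + 3) * ((m + 2) * (m + 1).factorial) := by
    rw [Nat.factorial_succ, ← f₂]; push_cast; ring
  rw [f₂] at h ⊢
  rw [f₃]
  push_cast
  refine lt_of_eq_of_lt ?_ (h.trans_eq ?_)
  · field_simp
    ring
  · field_simp
    ring
end
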